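/- Let ℓ ≥ 7 be an odd integer and let v be a positive integer with v ≡ ℓ (mod 2ℓ). Then the complete graph K_v admits an equitably 2-colourable ℓ-cycle decomposition. -/

import Mathlib

/-- The edge set of the cycle represented by `c : ZMod n → V`
(vertices listed in cyclic order). -/
def cycEdges {V : Type} {n : ℕ} [NeZero n] (c : ZMod n → V) : Set (Sym2 V) :=
  Set.range fun j => s(c j, c (j + 1))

/-- The family `cyc` of `n`-cycles is an `n`-cycle decomposition of the graph `G`:
each `cyc i` is an injective cyclic sequence of adjacent vertices, and every edge
of `G` lies on exactly one of the cycles. -/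
def IsCycleDecomp {V : Type} {n : ℕ} [NeZero n] (G : SimpleGraph V)
    {ι : Type} (cyc : ι → ZMod n → V) : Prop :=
  (∀ i, Function.Injective (cyc i)) ∧
  (∀ i j, G.Adj (cyc i j) (cyc i (j + 1))) ∧
  (∀ e, e ∈ G.edgeSet ↔ ∃! i, e ∈ cycEdges (cyc i))

/-- Number of vertices of the cycle `c` coloured `true` (red). -/
def redCount {V : Type} {n : ℕ} [NeZero n] (colour : V → Bool) (c : ZMod n → V) : ℕ :=
  (Finset.univ.filter fun j => colour (c j) = true).card

/-- The cycle `c` is equitably 2-coloured: each colour appears on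
`⌊n/2⌋` or `⌈n/2⌉` of its vertices. -/
def IsEquitable {V : Type} {n : ℕ} [NeZero n] (colour : V → Bool) (c : ZMod n → V) : Prop :=
  redCount colour c = n / 2 ∨ redCount colour c = (n + 1) / 2

/-- `G` admits an equitably 2-colourable decomposition into cycles of length `n`. -/
def HasEquitable2Decomp {V : Type} (G : SimpleGraph V) (n : ℕ) [NeZero n] : Prop :=
  ∃ (ι : Type) (cyc : ι → ZMod n → V) (colour : V → Bool),
    IsCycleDecomp G cyc ∧ ∀ i, IsEquitable colour (cyc i)



theorem decomp_of_cover {V : Type} [Fintype V] [DecidableEq V] {n : ℕ} [NeZero n] (hn : 2 ≤ n)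
    {ι : Type} [Fintype ι] (cyc : ι → ZMod n → V) (inj : ∀ i, Function.Injective (cyc i))
    (cover : ∀ u w, u ≠ w → ∃ i j, s(cyc i j, cyc i (j+1)) = s(u,w))
    (card : Fintype.card ι * n = (Fintype.card V).choose 2) :
    IsCycleDecomp (⊤ : SimpleGraph V) cyc := by
  have hne : ∀ i j, cyc i j ≠ cyc i (j+1) := by
    intro i j h
    have h1 := inj i h
    have h2 : (1 : ZMod n) = 0 := by
      have := congrArg (fun x => x - j) h1
      simpa using this.symm
    have : Fact (1 < n) := ⟨by omega⟩
    exact one_ne_zero h2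
  refine ⟨inj, fun i j => by simpa using hne i j, ?_⟩
  let F : ι × ZMod n → {e : Sym2 V // ¬ e.IsDiag} :=
    fun p => ⟨s(cyc p.1 p.2, cyc p.1 (p.2+1)), by simpa using hne p.1 p.2⟩
  have hs : Function.Surjective F := by
    rintro ⟨e, he⟩
    induction e using Sym2.ind with
    | _ u w =>
      obtain ⟨i, j, h⟩ := cover u w (by simpa using he)
      exact ⟨(i, j), Subtype.ext h⟩
  have hb : Function.Bijective F := by
    rw [Fintype.bijective_iff_surjective_and_card]
    refine ⟨hs, ?_⟩
    rw [Sym2.card_subtype_not_diag, ← card, Fintype.card_prod, ZMod.card]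
  intro e
  constructor
  · intro he
    have he' : ¬ e.IsDiag := SimpleGraph.not_isDiag_of_mem_edgeSet _ he
    obtain ⟨⟨i, j⟩, hij⟩ := hs ⟨e, he'⟩
    refine ⟨i, ⟨j, congrArg Subtype.val hij⟩, ?_⟩
    rintro i' ⟨j', hj'⟩
    have : F (i', j') = F (i, j) := by
      rw [hij]; exact Subtype.ext hj'
    exact congrArg Prod.fst (hb.1 this)
  · rintro ⟨i, ⟨j, rfl⟩, -⟩
    simpa using hne i j

theorem transfer {V W : Type} (ε : V ≃ W) {n : ℕ} [NeZero n]
    (H : HasEquitable2Decomp (⊤ : SimpleGraph V) n) :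
    HasEquitable2Decomp (⊤ : SimpleGraph W) n := by
  obtain ⟨ι, cyc, col, ⟨h1, h2, h3⟩, h4⟩ := H
  refine ⟨ι, fun i j => ε (cyc i j), fun w => col (ε.symm w), ⟨?_, ?_, ?_⟩, ?_⟩
  · intro i; exact ε.injective.comp (h1 i)
  · intro i j
    have := h2 i j
    simpa using this
  · intro e
    obtain ⟨e, rfl⟩ := (Sym2.map.injective ε.injective |> fun _ => (⟨e.map ε.symm, by simp [Sym2.map_map]⟩ : ∃ e', Sym2.map ε e' = e))
    have h5 : ∀ i, Sym2.map ε e ∈ cycEdges (fun j => ε (cyc i j)) ↔ e ∈ cycEdges (cyc i) := by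
      intro i
      constructor
      · rintro ⟨j, hj⟩
        exact ⟨j, Sym2.map.injective ε.injective (by simpa using hj)⟩
      · rintro ⟨j, rfl⟩
        exact ⟨j, by simp⟩
    have h6 : Sym2.map ε e ∈ (⊤ : SimpleGraph W).edgeSet ↔ e ∈ (⊤ : SimpleGraph V).edgeSet := by
      induction e using Sym2.ind with
      | _ u w => simp
    rw [h6, h3]
    simp only [h5]
  · intro i
    have := h4 i
    simpa [IsEquitable, redCount] using this

/-- position-wise access -/
theorem natpos {ℓ : ℕ} [NeZero ℓ] (j : ℕ) (hj : j + 1 < ℓ) :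
    ((j : ZMod ℓ)).val = j ∧ ((j : ZMod ℓ) + 1).val = j + 1 := by
  refine ⟨ZMod.val_natCast_of_lt (by omega), ?_⟩
  have : ((j : ZMod ℓ) + 1) = ((j+1 : ℕ) : ZMod ℓ) := by push_cast; rfl
  rw [this, ZMod.val_natCast_of_lt hj]

theorem lastpos {ℓ : ℕ} [NeZero ℓ] :
    (((ℓ - 1 : ℕ) : ZMod ℓ)).val = ℓ - 1 ∧ (((ℓ-1 : ℕ) : ZMod ℓ) + 1).val = 0 := by
  have h0 : 0 < ℓ := Nat.pos_of_ne_zero (NeZero.ne ℓ)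
  refine ⟨ZMod.val_natCast_of_lt (by omega), ?_⟩
  have : (((ℓ-1 : ℕ) : ZMod ℓ) + 1) = ((ℓ-1+1 : ℕ) : ZMod ℓ) := by push_cast; rfl
  rw [this, Nat.sub_add_cancel h0]; simp

/-- Walecki -/
def wal (h s j : ℕ) : ℕ :=
  if j = 2 * h then 2 * h else
    if j % 2 = 0 then (if j / 2 ≤ s then s - j / 2 else s + 2 * h - j / 2)
    else (if s + (j / 2 + 1) < 2 * h then s + (j/2+1) else s + (j/2+1) - 2 * h)

theorem wal_lt (h s j : ℕ) (hs : s < h) (hj : j < 2*h+1) : wal h s j < 2*h+1 := by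
  unfold wal; split_ifs <;> omega

theorem wal_inj (h s j j' : ℕ) (hs : s < h) (hj : j < 2*h+1) (hj' : j' < 2*h+1)
    (e : wal h s j = wal h s j') : j = j' := by
  unfold wal at e; split_ifs at e <;> omega

theorem wal_cover (h u w : ℕ) (hu : u < w) (hw : w < 2*h+1) :
    ∃ s j, s < h ∧ ((j < 2*h ∧ ((wal h s j = u ∧ wal h s (j+1) = w) ∨ (wal h s j = w ∧ wal h s (j+1) = u)))
      ∨ (wal h s (2*h) = w ∧ wal h s 0 = u)) := by
  by_cases h1 : w = 2*h
  · subst h1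
    by_cases h2 : u < h
    · exact ⟨u, 0, h2, Or.inr ⟨by simp [wal], by unfold wal; split_ifs <;> omega⟩⟩
    · refine ⟨u - h, 2*h-1, by omega, Or.inl ⟨by omega, Or.inl ⟨?_, ?_⟩⟩⟩
      · unfold wal; split_ifs <;> omega
      · unfold wal; split_ifs <;> omega
  · -- both finite
    obtain ⟨σ, hσ1, hσ2⟩ : ∃ σ, σ < 2*h ∧ (u + w = σ ∨ u + w = σ + 2*h) := by
      by_cases h3 : u + w < 2*h
      · exact ⟨u+w, h3, Or.inl rfl⟩
      · exact ⟨u+w-2*h, by omega, Or.inr (by omega)⟩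
    obtain ⟨s, hs⟩ : ∃ s, σ = 2*s ∨ σ = 2*s+1 := ⟨σ/2, by omega⟩
    have hsh : s < h := by omega
    rcases hσ2 with hσ2 | hσ2 <;> rcases hs with hs | hs
    · -- u = s - t, w = s + t
      refine ⟨s, 2*(w-s)-1, hsh, Or.inl ⟨by omega, Or.inr ⟨?_, ?_⟩⟩⟩ <;>
      · unfold wal; split_ifs <;> omega
    · refine ⟨s, 2*(w-s-1), hsh, Or.inl ⟨by omega, Or.inl ⟨?_, ?_⟩⟩⟩ <;>
      · unfold wal; split_ifs <;> omega
    · -- u + w = 2s + 2h ; u-s + w-s = 2h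
      by_cases h4 : u < s + h
      · refine ⟨s, 2*(u-s)-1, hsh, Or.inl ⟨by omega, Or.inl ⟨?_, ?_⟩⟩⟩ <;>
        · unfold wal; split_ifs <;> omega
      · omega
    · refine ⟨s, 2*(u-s-1), hsh, Or.inl ⟨by omega, Or.inr ⟨?_, ?_⟩⟩⟩ <;>
      · unfold wal; split_ifs <;> omega

/-- red indicator -/
def rd {X : Type} (col : X → Bool) (x : X) : ℕ := if col x = true then 1 else 0

/-- The combinatorial structure on `ZMod ℓ`, without the colouring condition. -/
structure XPre (ℓ h : ℕ) (e : ZMod ℓ) (c : ZMod ℓ → ℕ → ZMod ℓ) : Prop where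
  first : ∀ i, c i 0 = i
  last : ∀ i, c i (2*h-1) = i
  inj : ∀ i j j', j < 2*h → j' < 2*h → j % 2 = j' % 2 → c i j = c i j' → j = j'
  cov : ∀ a d : ZMod ℓ, d ≠ a + e → a ≠ d + e → ∃ i j, j + 1 < 2*h ∧
    ((j % 2 = 0 ∧ c i j = a ∧ c i (j+1) = d) ∨ (j % 2 = 1 ∧ c i (j+1) = a ∧ c i j = d))

/-- number of red vertices of the `i`-th cycle -/
def xcnt {ℓ : ℕ} (h : ℕ) (e : ZMod ℓ) (c : ZMod ℓ → ℕ → ZMod ℓ) (col : ZMod ℓ → Bool) (i : ZMod ℓ) : ℕ :=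
  (∑ j ∈ Finset.range (2*h), rd col (c i j)) + rd col (i + e)

def XOk (ℓ h : ℕ) [NeZero ℓ] : Prop :=
  ∃ (col : ZMod ℓ → Bool) (e : ZMod ℓ) (c : ZMod ℓ → ℕ → ZMod ℓ),
    XPre ℓ h e c ∧ (∑ x, rd col x) = h ∧
    ∀ i, xcnt h e c col i = h ∨ xcnt h e c col i = h + 1

/-- the long cycles -/
def bigc {ℓ m : ℕ} (h : ℕ) (e : ZMod ℓ) (c : ZMod ℓ → ℕ → ZMod ℓ) (y d : ZMod m) (i : ZMod ℓ)
    (j : ℕ) : ZMod m × ZMod ℓ :=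
  if j < 2*h then ((if j % 2 = 0 then y - d else y + d), c i j) else (y, i + e)

theorem half_class (m k : ℕ) [NeZero m] (hm : m = 2*k+1) (z : ZMod m) (hz : z ≠ 0) :
    ∃ t : Fin k, z = ((t : ℕ) : ZMod m) + 1 ∨ z = -(((t : ℕ) : ZMod m) + 1) := by
  have h1 : z.val ≠ 0 := by rwa [Ne, ZMod.val_eq_zero]
  have h2 := ZMod.val_lt z
  by_cases h3 : z.val ≤ k
  · refine ⟨⟨z.val - 1, by omega⟩, Or.inl ?_⟩
    have : (((z.val - 1 + 1 : ℕ)) : ZMod m) = z := by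
      rw [Nat.sub_add_cancel (by omega)]; simp
    simpa using this.symm
  · refine ⟨⟨m - z.val - 1, by omega⟩, Or.inr ?_⟩
    have : (((m - z.val - 1 + 1 : ℕ)) : ZMod m) = - z := by
      rw [Nat.sub_add_cancel (by omega), Nat.cast_sub (by omega)]; simp
    push_cast at this
    simp [this]

theorem two_d_ne (m k : ℕ) [NeZero m] (hm : m = 2*k+1) (t : Fin k) :
    (((t : ℕ) : ZMod m) + 1) + (((t : ℕ) : ZMod m) + 1) ≠ 0 := by
  intro h
  have : ((2 * (t.val + 1) : ℕ) : ZMod m) = 0 := by push_cast; rw [← h]; ring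
  rw [ZMod.natCast_eq_zero_iff] at this
  have := Nat.le_of_dvd (by omega) this
  have := t.2
  omega

theorem bigc_inj {ℓ m : ℕ} {h : ℕ} {e : ZMod ℓ} {c : ZMod ℓ → ℕ → ZMod ℓ} (H : XPre ℓ h e c)
    (y d : ZMod m) (hd : d + d ≠ 0) (i : ZMod ℓ) (j j' : ℕ) (hj : j < 2*h+1) (hj' : j' < 2*h+1)
    (E : bigc h e c y d i j = bigc h e c y d i j') : j = j' := by
  have hd0 : d ≠ 0 := by rintro rfl; simp at hd
  have hm1 : y - d ≠ y + d := by
    intro h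
    apply hd
    have : y + d - (y - d) = 0 := by rw [h]; ring
    rw [← this]; ring
  have hm2 : y - d ≠ y := by intro h; apply hd0; simpa using h
  have hm3 : y + d ≠ y := by intro h; apply hd0; simpa using h
  unfold bigc at E
  split_ifs at E with a1 a2 a3 a4 a5 a6 <;> simp only [Prod.mk.injEq] at E
  · exact H.inj i j j' (by assumption) (by assumption) (by omega) E.2
  · exact absurd E.1 hm1
  · exact absurd E.1 hm2
  · exact absurd E.1.symm hm1
  · exact H.inj i j j' (by assumption) (by assumption) (by omega) E.2
  · exact absurd E.1 hm3
  · exact absurd E.1.symm hm2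
  · exact absurd E.1.symm hm3
  · omega

theorem sum_zmod {ℓ : ℕ} [NeZero ℓ] (F : ℕ → ℕ) : ∑ j : ZMod ℓ, F j.val = ∑ j ∈ Finset.range ℓ, F j := by
  cases ℓ with
  | zero => exact absurd rfl (NeZero.ne 0)
  | succ n => exact (Fin.sum_univ_eq_sum_range F (n+1))

theorem redCount_eq {V : Type} {n : ℕ} [NeZero n] (colour : V → Bool) (c : ZMod n → V) :
    redCount colour c = ∑ j, rd colour (c j) := by
  unfold redCount rd
  rw [Finset.card_filter]

theorem main_of_X (ℓ h m k : ℕ) [NeZero ℓ] (hℓ : ℓ = 2*h+1) (hh : 1 ≤ h) (hm : m = 2*k+1)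
    (H : XOk ℓ h) : HasEquitable2Decomp (⊤ : SimpleGraph (Fin (m * ℓ))) ℓ := by
  classical
  obtain ⟨col, e, c, hp, hcol, hcnt⟩ := H
  have : NeZero m := ⟨by omega⟩
  let D : Fin k → ZMod m := fun t => ((t : ℕ) : ZMod m) + 1
  let cyc : (ZMod m × Fin h) ⊕ (ZMod m × Fin k × ZMod ℓ) → ZMod ℓ → ZMod m × ZMod ℓ := fun p =>
    match p with
    | Sum.inl q => fun j => (q.1, ((wal h q.2 j.val : ℕ) : ZMod ℓ))
    | Sum.inr q => fun j => bigc h e c q.1 (D q.2.1) q.2.2 j.val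
  have inj : ∀ p, Function.Injective (cyc p) := by
    rintro (⟨y, s⟩ | ⟨y, t, i⟩) j j' hjj
    · have h1 : ((wal h s j.val : ℕ) : ZMod ℓ) = ((wal h s j'.val : ℕ) : ZMod ℓ) := congrArg Prod.snd hjj
      have h2 := ZMod.val_lt j
      have h3 := ZMod.val_lt j'
      have h4 := congrArg ZMod.val h1
      have h5 := wal_lt h s j.val s.2 (by omega)
      have h6 := wal_lt h s j'.val s.2 (by omega)
      rw [ZMod.val_natCast_of_lt (by omega), ZMod.val_natCast_of_lt (by omega)] at h4
      exact ZMod.val_injective _ (wal_inj h s _ _ s.2 (by omega) (by omega) h4)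
    · have h2 := ZMod.val_lt j
      have h3 := ZMod.val_lt j'
      exact ZMod.val_injective _ (bigc_inj hp y (D t) (two_d_ne m k hm t) i _ _ (by omega) (by omega) hjj)
  refine transfer (V := ZMod m × ZMod ℓ) (Fintype.equivOfCardEq (by simp [ZMod.card])) ⟨_, cyc, fun x => col x.2, ?_, ?_⟩
  · apply decomp_of_cover (by omega) cyc inj
    · -- cover
      have hsymm : ∀ u w, (∃ p j, s(cyc p j, cyc p (j+1)) = s(u,w)) → (∃ p j, s(cyc p j, cyc p (j+1)) = s(w,u)) := by
        rintro u w ⟨p, j, hj⟩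
        exact ⟨p, j, hj.trans Sym2.eq_swap⟩
      have hk2 : ((k : ZMod m) + 1) + ((k : ZMod m) + 1) = 1 := by
        have : ((2*k+1 : ℕ) : ZMod m) = 0 := by rw [← hm]; simp
        push_cast at this
        linear_combination this
      -- apex edges
      have hapex : ∀ (u w : ZMod m) (a : ZMod ℓ), u ≠ w →
          ∃ p j, s(cyc p j, cyc p (j+1)) = s((u,a),(w,a+e)) := by
        intro u w a huw
        obtain ⟨t, ht⟩ := half_class m k hm (w - u) (sub_ne_zero.mpr (Ne.symm huw))
        rcases ht with ht | ht
        · refine ⟨Sum.inr (w, t, a), ((ℓ-1 : ℕ) : ZMod ℓ), ?_⟩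
          have hl := lastpos (ℓ := ℓ)
          simp only [cyc, hl.1, hl.2, bigc]
          rw [if_neg (show ¬ (ℓ - 1 < 2*h) by omega), if_pos (show 0 < 2*h by omega), hp.first, if_pos trivial, Sym2.eq_swap]
          congr 2
          simp only [D]; rw [← ht]; congr 1; ring
        · refine ⟨Sum.inr (w, t, a), ((2*h-1 : ℕ) : ZMod ℓ), ?_⟩
          have hl := natpos (ℓ := ℓ) (2*h-1) (by omega)
          simp only [cyc, hl.1, hl.2, bigc]
          rw [if_pos (show 2*h-1 < 2*h by omega), if_neg (show ¬ (2*h-1+1 < 2*h) by omega), hp.last, if_neg (show ¬ ((2*h-1) % 2 = 0) by omega)]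
          congr 2
          simp only [D]
          have : u = w + (((t:ℕ) : ZMod m) + 1) := by linear_combination -ht
          rw [this]
      have hac : ∀ (y : ZMod m) (t : Fin k) (a d : ZMod ℓ), d ≠ a + e → a ≠ d + e →
          ∃ p j, s(cyc p j, cyc p (j+1)) = s((y - D t,a),(y + D t,d)) := by
        intro y t a d h1 h2
        obtain ⟨i, j, hj, hc⟩ := hp.cov a d h1 h2
        refine ⟨Sum.inr (y, t, i), (j : ZMod ℓ), ?_⟩
        have hl := natpos (ℓ := ℓ) j (by omega)
        simp only [cyc, hl.1, hl.2, bigc]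
        rw [if_pos (show j < 2*h by omega), if_pos hj]
        rcases hc with ⟨h3, h4, h5⟩ | ⟨h3, h4, h5⟩
        · rw [if_pos h3, if_neg (show ¬ ((j+1) % 2 = 0) by omega), h4, h5]
        · rw [if_neg (show ¬ (j % 2 = 0) by omega), if_pos (show (j+1) % 2 = 0 by omega), h4, h5, Sym2.eq_swap]
      rintro ⟨u, a⟩ ⟨w, d⟩ hne
      by_cases huw : u = w
      · subst huw
        have had : a ≠ d := by rintro rfl; exact hne rfl
        have key : ∀ a d : ZMod ℓ, a.val < d.val → ∃ p j, s(cyc p j, cyc p (j+1)) = s((u,a),(u,d)) := by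
          intro a d hlt
          have hdl := ZMod.val_lt d
          obtain ⟨s, j, hs, hc⟩ := wal_cover h a.val d.val hlt (by omega)
          rcases hc with ⟨hj, hc⟩ | hc
          · refine ⟨Sum.inl (u, ⟨s, hs⟩), (j : ZMod ℓ), ?_⟩
            have hl := natpos (ℓ := ℓ) j (by omega)
            simp only [cyc, hl.1, hl.2]
            rcases hc with ⟨h3, h4⟩ | ⟨h3, h4⟩
            · rw [h3, h4]; simp
            · rw [h3, h4, Sym2.eq_swap]; simp
          · refine ⟨Sum.inl (u, ⟨s, hs⟩), ((ℓ-1 : ℕ) : ZMod ℓ), ?_⟩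
            have hl := lastpos (ℓ := ℓ)
            simp only [cyc, hl.1, hl.2]
            rw [show ℓ - 1 = 2*h by omega, hc.1, hc.2, Sym2.eq_swap]; simp
        rcases lt_trichotomy a.val d.val with hlt | heq | hlt
        · exact key a d hlt
        · exact absurd (ZMod.val_injective _ heq) had
        · exact hsymm _ _ (key d a hlt)
      · by_cases h1 : d = a + e
        · subst h1; exact hapex u w a huw
        · by_cases h2 : a = d + e
          · subst h2; exact hsymm _ _ (hapex w u d (Ne.symm huw))
          · have hz : ((k : ZMod m) + 1) * (w - u) ≠ 0 := by
              intro h0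
              apply huw
              have : w - u = 0 := by linear_combination (2:ZMod m) * h0 - (w-u) * hk2
              exact (sub_eq_zero.mp this).symm
            obtain ⟨t, ht⟩ := half_class m k hm _ hz
            rcases ht with ht | ht
            · have := hac (((k : ZMod m) + 1) * (u + w)) t a d h1 h2
              have e1 : ((k : ZMod m) + 1) * (u + w) - D t = u := by
                simp only [D]; rw [← ht]; linear_combination u * hk2
              have e2 : ((k : ZMod m) + 1) * (u + w) + D t = w := by
                simp only [D]; rw [← ht]; linear_combination w * hk2
              rwa [e1, e2] at this
            · have := hac (((k : ZMod m) + 1) * (u + w)) t d a h2 h1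
              have e1 : ((k : ZMod m) + 1) * (u + w) - D t = w := by
                simp only [D]; linear_combination w * hk2 - ht
              have e2 : ((k : ZMod m) + 1) * (u + w) + D t = u := by
                simp only [D]; linear_combination u * hk2 + ht
              rw [e1, e2] at this
              exact hsymm _ _ this
    · -- card
      simp only [Fintype.card_sum, Fintype.card_prod, ZMod.card, Fintype.card_fin]
      rw [Nat.choose_two_right]
      have : m * ℓ * (m * ℓ - 1) = 2 * ((m * h + m * (k * ℓ)) * ℓ) := by
        have h1 : m * ℓ - 1 = 2 * (2*k*h+k+h) := by
          rw [hm, hℓ]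
          have : (2*k+1)*(2*h+1) = 2 * (2*k*h+k+h) + 1 := by ring
          omega
        rw [h1, hm, hℓ]; ring
      rw [this]; simp
  · have h2 : ℓ / 2 = h := by omega
    have h3 : (ℓ + 1) / 2 = h + 1 := by omega
    rintro (⟨y, s⟩ | ⟨y, t, i⟩)
    · left
      rw [redCount_eq, h2]; refine Eq.trans ?_ hcol
      have hinj : Function.Injective (fun j => (cyc (Sum.inl (y,s)) j).2) := by
        intro j j' hjj
        exact inj (Sum.inl (y,s)) (Prod.ext rfl hjj)
      have hbij := Finite.injective_iff_bijective.mp hinj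
      exact Function.Bijective.sum_comp hbij (fun x => rd col x)
    · unfold IsEquitable
      rw [h2, h3, redCount_eq]
      have : ∑ j, rd (fun x : ZMod m × ZMod ℓ => col x.2) (cyc (Sum.inr (y,t,i)) j) = xcnt h e c col i := by
        refine Eq.trans (sum_zmod (fun n => rd (fun x : ZMod m × ZMod ℓ => col x.2) (bigc h e c y (D t) i n))) ?_
        have hr : Finset.range ℓ = Finset.range (2*h+1) := congrArg Finset.range hℓ
        rw [hr, Finset.sum_range_succ]
        unfold xcnt
        congr 1
        · apply Finset.sum_congr rfl
          intro j hj
          rw [Finset.mem_range] at hj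
          simp [bigc, hj, rd]
        · simp [bigc, rd]
      rw [this]
      exact hcnt i

/-- table of a small solution: base path plus overrides -/
def cf (l : ℕ) (P : List ℕ) (O : List (ℕ × ℕ)) (i j : ℕ) : ℕ :=
  (O.lookup (i * 100 + j)).getD ((P.getD j 0 + i) % l)

def orN : ℕ → (ℕ → ℕ) → ℕ
  | 0, _ => 0
  | n+1, f => f n ||| orN n f

theorem orN_bit (n : ℕ) (f : ℕ → ℕ) (x : ℕ) (h : (orN n f).testBit x = true) :
    ∃ k, k < n ∧ (f k).testBit x = true := by
  induction n with
  | zero => simp [orN] at h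
  | succ n ih =>
    rw [orN, Nat.testBit_or, Bool.or_eq_true] at h
    rcases h with h | h
    · exact ⟨n, by omega, h⟩
    · obtain ⟨k, hk, hk'⟩ := ih h
      exact ⟨k, by omega, hk'⟩

def keyf (l : ℕ) (f : ℕ → ℕ → ℕ) (i j : ℕ) : ℕ :=
  if j % 2 = 0 then f i j * l + f i (j+1) else f i (j+1) * l + f i j

def bt (R n : ℕ) : ℕ := if R.testBit n = true then 1 else 0

structure SmallOk (l h e R : ℕ) (f : ℕ → ℕ → ℕ) : Prop where
  first : ∀ i, i < l → f i 0 = i ∧ f i (2*h-1) = i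
  lt : ∀ i, i < l → ∀ j, j < 2*h → f i j < l
  inj : ∀ i, i < l → ∀ j, j < 2*h → ∀ j', j' < j → j % 2 = j' % 2 → f i j ≠ f i j'
  cov : ∃ M, M = orN l (fun i => orN (2*h-1) (fun j => 1 <<< keyf l f i j)) ∧
    ∀ a, a < l → ∀ d, d < l → d ≠ (a + e) % l → a ≠ (d + e) % l → M.testBit (a * l + d) = true
  col : ∑ x ∈ Finset.range l, bt R x = h
  cnt : ∀ i, i < l → (∑ j ∈ Finset.range (2*h), bt R (f i j)) + bt R ((i + e) % l) = h ∨
    (∑ j ∈ Finset.range (2*h), bt R (f i j)) + bt R ((i + e) % l) = h + 1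

theorem XOk_of_small (l h e R : ℕ) (f : ℕ → ℕ → ℕ) [NeZero l] (H : SmallOk l h e R f) : XOk l h := by
  refine ⟨fun x => R.testBit x.val, (e : ZMod l), fun i j => ((f i.val j : ℕ) : ZMod l), ⟨?_, ?_, ?_, ?_⟩, ?_, ?_⟩
  · intro i
    rw [(H.first i.val (ZMod.val_lt i)).1]; simp
  · intro i
    rw [(H.first i.val (ZMod.val_lt i)).2]; simp
  · intro i j j' hj hj' hp he
    have h4 := congrArg ZMod.val he
    have hi := ZMod.val_lt i
    rw [ZMod.val_natCast_of_lt (H.lt _ hi _ hj), ZMod.val_natCast_of_lt (H.lt _ hi _ hj')] at h4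
    rcases lt_trichotomy j j' with h5 | h5 | h5
    · exact absurd h4.symm (H.inj _ hi _ hj' _ h5 hp.symm)
    · exact h5
    · exact absurd h4 (H.inj _ hi _ hj _ h5 hp)
  · intro a d h1 h2
    obtain ⟨M, hM, hc⟩ := H.cov
    have hd := ZMod.val_lt d
    have ha := ZMod.val_lt a
    have := hc a.val ha d.val hd
      (by
        intro h3; apply h1
        have := congrArg (Nat.cast (R := ZMod l)) h3
        simpa using this)
      (by
        intro h3; apply h2
        have := congrArg (Nat.cast (R := ZMod l)) h3
        simpa using this)
    rw [hM] at this
    obtain ⟨i, hi, h3⟩ := orN_bit _ _ _ this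
    obtain ⟨j, hj, h4⟩ := orN_bit _ _ _ h3
    have hk : keyf l f i j = a.val * l + d.val := by
      simpa [Nat.one_shiftLeft, Nat.testBit_two_pow] using h4
    have hl1 := H.lt i hi j (by omega)
    have hl2 := H.lt i hi (j+1) (by omega)
    have key : ∀ x y : ℕ, x < l → y < l → x * l + y = a.val * l + d.val → x = a.val ∧ y = d.val := by
      intro x y hx hy hxy
      have e1 := congrArg (· / l) hxy
      have e2 := congrArg (· % l) hxy
      have hl0 : 0 < l := by omega
      simp only [Nat.mul_comm _ l, Nat.mul_add_div hl0, Nat.mul_add_mod,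
        Nat.div_eq_of_lt hy, Nat.div_eq_of_lt hd, Nat.mod_eq_of_lt hy, Nat.mod_eq_of_lt hd] at e1 e2
      exact ⟨by omega, e2⟩
    refine ⟨(i : ZMod l), j, by omega, ?_⟩
    rw [ZMod.val_natCast_of_lt hi]
    unfold keyf at hk
    split_ifs at hk with hp
    · obtain ⟨e1, e2⟩ := key _ _ hl1 hl2 hk
      left; refine ⟨hp, ?_, ?_⟩
      · rw [e1]; simp
      · rw [e2]; simp
    · obtain ⟨e1, e2⟩ := key _ _ hl2 hl1 hk
      right; refine ⟨by omega, ?_, ?_⟩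
      · rw [e1]; simp
      · rw [e2]; simp
  · exact (sum_zmod (fun n => bt R n)).trans H.col
  · intro i
    have hi := ZMod.val_lt i
    have : xcnt h (e : ZMod l) (fun i j => ((f i.val j : ℕ) : ZMod l)) (fun x => R.testBit x.val) i =
      (∑ j ∈ Finset.range (2*h), bt R (f i.val j)) + bt R ((i.val + e) % l) := by
      unfold xcnt
      congr 1
      · apply Finset.sum_congr rfl
        intro j hj
        rw [Finset.mem_range] at hj
        unfold rd bt
        beta_reduce
        rw [ZMod.val_natCast_of_lt (H.lt _ hi _ hj)]
      · unfold rd bt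
        have : i + (e : ZMod l) = ((i.val + e : ℕ) : ZMod l) := by simp
        rw [this]
        beta_reduce
        rw [ZMod.val_natCast]
    rw [this]
    exact H.cnt _ hi

theorem small_7 : XOk 7 3 :=
  XOk_of_small 7 3 1 7 (cf 7 [0, 0, 0, 0, 0, 0] [(1, 3), (2, 3), (3, 5), (4, 5), (101, 3), (102, 6), (103, 6), (104, 3), (201, 4), (202, 4), (203, 1), (204, 6), (301, 0), (302, 2), (303, 2), (304, 5), (401, 0), (402, 0), (403, 5), (404, 1), (501, 1), (502, 1), (503, 6), (504, 2), (601, 4), (602, 0), (603, 2), (604, 4)]) (by constructor <;> first | decide +kernel | exact ⟨_, rfl, by decide +kernel⟩)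

theorem small_9 : XOk 9 4 :=
  XOk_of_small 9 4 7 15 (cf 9 [0, 1, 5, 4, 4, 7, 3, 0] [(103, 0), (205, 5), (403, 3), (505, 8)]) (by constructor <;> first | decide +kernel | exact ⟨_, rfl, by decide +kernel⟩)

theorem small_11 : XOk 11 5 :=
  XOk_of_small 11 5 3 199 (cf 11 [0, 1, 8, 8, 9, 7, 5, 10, 4, 0] [(8, 1), (208, 3), (304, 4), (504, 6)]) (by constructor <;> first | decide +kernel | exact ⟨_, rfl, by decide +kernel⟩)

theorem small_13 : XOk 13 6 :=
  XOk_of_small 13 6 10 1365 (cf 13 [0, 1, 12, 6, 11, 7, 9, 8, 8, 12, 7, 0] [(401, 8), (701, 11), (909, 5), (1209, 8)]) (by constructor <;> first | decide +kernel | exact ⟨_, rfl, by decide +kernel⟩)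

theorem small_15 : XOk 15 7 :=
  XOk_of_small 15 7 6 1807 (cf 15 [0, 4, 1, 3, 2, 9, 14, 10, 13, 11, 12, 12, 7, 0] [(308, 11), (603, 11), (701, 9), (1002, 1)]) (by constructor <;> first | decide +kernel | exact ⟨_, rfl, by decide +kernel⟩)

theorem small_19 : XOk 19 9 :=
  XOk_of_small 19 9 2 15391 (cf 19 [0, 5, 5, 6, 3, 7, 17, 8, 16, 9, 15, 10, 14, 11, 12, 1, 13, 0] [(3, 2), (13, 15), (903, 11), (1013, 6)]) (by constructor <;> first | decide +kernel | exact ⟨_, rfl, by decide +kernel⟩)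

theorem small_21 : XOk 21 10 :=
  XOk_of_small 21 10 10 1968065 (cf 21 [0, 12, 20, 13, 19, 14, 18, 15, 17, 5, 5, 6, 4, 7, 3, 8, 2, 9, 1, 0] [(2, 12), (702, 13), (710, 20), (1116, 6)]) (by constructor <;> first | decide +kernel | exact ⟨_, rfl, by decide +kernel⟩)

theorem small_23 : XOk 23 11 :=
  XOk_of_small 23 11 2 2047 (cf 23 [0, 3, 22, 4, 21, 5, 20, 6, 19, 7, 18, 14, 17, 8, 16, 9, 15, 10, 11, 11, 10, 0] [(3, 22), (1105, 9), (1119, 4), (1205, 10), (2119, 16), (2219, 17)]) (by constructor <;> first | decide +kernel | exact ⟨_, rfl, by decide +kernel⟩)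

theorem small_27 : XOk 27 13 :=
  XOk_of_small 27 13 10 1032319 (cf 27 [0, 9, 1, 8, 2, 7, 3, 6, 4, 20, 20, 19, 21, 18, 22, 17, 23, 16, 24, 15, 14, 25, 13, 26, 12, 0] [(206, 11), (312, 18), (318, 11), (1002, 0), (1012, 25), (1506, 24), (1712, 5), (1717, 12), (2011, 6), (2206, 4)]) (by constructor <;> first | decide +kernel | exact ⟨_, rfl, by decide +kernel⟩)

theorem small_31 : XOk 31 15 :=
  XOk_of_small 31 15 12 8323327 (cf 31 [0, 11, 1, 10, 2, 9, 3, 8, 4, 7, 5, 23, 23, 22, 24, 21, 25, 20, 26, 19, 27, 18, 28, 17, 16, 29, 15, 30, 14, 0] [(202, 23), (1201, 5), (1216, 29), (1719, 23), (2309, 5), (2508, 6), (2603, 30), (2622, 3)]) (by constructor <;> first | decide +kernel | exact ⟨_, rfl, by decide +kernel⟩)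

theorem small_35 : XOk 35 17 :=
  XOk_of_small 35 17 14 66847231 (cf 35 [0, 13, 1, 12, 2, 11, 3, 10, 4, 9, 5, 8, 6, 26, 26, 25, 27, 24, 28, 23, 29, 22, 30, 21, 31, 20, 32, 19, 18, 33, 17, 34, 16, 0] [(204, 26), (1216, 33), (1226, 20), (1902, 9), (2611, 5), (2810, 4), (2905, 34), (2926, 4)]) (by constructor <;> first | decide +kernel | exact ⟨_, rfl, by decide +kernel⟩)


/-- base cycles obtained by translating a path -/
def cb {ℓ : ℕ} (P : ℕ → ℤ) (i : ZMod ℓ) (j : ℕ) : ZMod ℓ := i + ((P j : ℤ) : ZMod ℓ)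

theorem cb_int {ℓ : ℕ} (P : ℕ → ℤ) (n : ℤ) (j : ℕ) :
    cb P ((n : ℤ) : ZMod ℓ) j = ((n + P j : ℤ) : ZMod ℓ) := by
  unfold cb; push_cast; rfl

theorem zc_elim {ℓ : ℕ} {x y : ℤ} (h : ((x : ℤ) : ZMod ℓ) = ((y : ℤ) : ZMod ℓ))
    (h1 : x - y < 3 * ℓ) (h2 : y - x < 3 * ℓ) :
    x = y ∨ x = y + ℓ ∨ x = y - ℓ ∨ x = y + 2 * ℓ ∨ x = y - 2 * ℓ := by
  rw [ZMod.intCast_eq_intCast_iff_dvd_sub] at h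
  obtain ⟨q, hq⟩ := h
  have hl : (0 : ℤ) < ℓ := by omega
  have a1 : q < 3 := by nlinarith
  have a2 : -3 < q := by nlinarith
  have : q = -2 ∨ q = -1 ∨ q = 0 ∨ q = 1 ∨ q = 2 := by omega
  rcases this with rfl | rfl | rfl | rfl | rfl <;> omega

theorem zc_intro {ℓ : ℕ} {x y : ℤ} (q : ℤ) (h : x = y + q * ℓ) :
    ((x : ℤ) : ZMod ℓ) = ((y : ℤ) : ZMod ℓ) := by
  rw [h]; push_cast; simp

theorem zc_rep {ℓ : ℕ} [NeZero ℓ] (i : ZMod ℓ) : ∃ n : ℤ, 0 ≤ n ∧ n < ℓ ∧ i = ((n : ℤ) : ZMod ℓ) := by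
  refine ⟨(i.val : ℤ), by omega, ?_, by simp⟩
  have := ZMod.val_lt i
  omega

theorem zc_rep_sym {ℓ h : ℕ} [NeZero ℓ] (hl : ℓ = 2*h+1) (i : ZMod ℓ) :
    ∃ n : ℤ, -h ≤ n ∧ n ≤ h ∧ i = ((n : ℤ) : ZMod ℓ) := by
  obtain ⟨n, h1, h2, h3⟩ := zc_rep i
  by_cases h4 : n ≤ h
  · exact ⟨n, by omega, h4, h3⟩
  · refine ⟨n - ℓ, by omega, by omega, ?_⟩
    rw [h3]; exact zc_intro 1 (by ring)

theorem XPre_base {ℓ h : ℕ} [NeZero ℓ] (hl : ℓ = 2*h+1) (P : ℕ → ℤ) (e : ℤ)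
    (h0 : P 0 = 0) (h1 : P (2*h-1) = 0)
    (hb : ∀ j, j < 2*h → P j < ℓ ∧ -ℓ < P j)
    (hi : ∀ j j', j < 2*h → j' < 2*h → j % 2 = j' % 2 → (P j = P j' ∨ P j = P j' + ℓ ∨ P j = P j' - ℓ) → j = j')
    (hc : ∀ d : ℤ, -h ≤ d → d ≤ h → d ≠ e → d ≠ -e → ∃ j, j + 1 < 2*h ∧ ∃ q : ℤ,
      ((j % 2 = 0 ∧ P (j+1) - P j = d + q * ℓ) ∨ (j % 2 = 1 ∧ P j - P (j+1) = d + q * ℓ))) :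
    XPre ℓ h ((e : ℤ) : ZMod ℓ) (cb P) := by
  refine ⟨?_, ?_, ?_, ?_⟩
  · intro i; simp [cb, h0]
  · intro i; simp [cb, h1]
  · intro i j j' hj hj' hp he
    have he' : ((P j : ℤ) : ZMod ℓ) = ((P j' : ℤ) : ZMod ℓ) := by simpa [cb] using he
    have b1 := hb j hj
    have b2 := hb j' hj'
    have := zc_elim he' (by omega) (by omega)
    exact hi j j' hj hj' hp (by omega)
  · intro a d h2 h3
    obtain ⟨x, hx1, hx2, hx⟩ := zc_rep_sym hl (d - a)
    have hd : d = a + ((x : ℤ) : ZMod ℓ) := by rw [← hx]; ring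
    obtain ⟨j, hj, q, hq⟩ := hc x hx1 hx2 (by rintro rfl; exact h2 hd)
      (by rintro rfl; apply h3; rw [hd]; push_cast; ring)
    rcases hq with ⟨hp, hq⟩ | ⟨hp, hq⟩
    · refine ⟨a - ((P j : ℤ) : ZMod ℓ), j, hj, Or.inl ⟨hp, by simp [cb], ?_⟩⟩
      have : ((P (j+1) - P j : ℤ) : ZMod ℓ) = ((x : ℤ) : ZMod ℓ) := zc_intro q hq
      rw [hd, ← this]; unfold cb; push_cast; ring
    · refine ⟨a - ((P (j+1) : ℤ) : ZMod ℓ), j, hj, Or.inr ⟨hp, by simp [cb], ?_⟩⟩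
      have : ((P j - P (j+1) : ℤ) : ZMod ℓ) = ((x : ℤ) : ZMod ℓ) := zc_intro q hq
      rw [hd, ← this]; unfold cb; push_cast; ring

/-- swap the centres of two paths of length two with the same ends -/
def tr {ℓ : ℕ} (c : ZMod ℓ → ℕ → ZMod ℓ) (i : ZMod ℓ) (p : ℕ) (k : ZMod ℓ) (q : ℕ) :
    ZMod ℓ → ℕ → ZMod ℓ := fun x j =>
  if x = i ∧ j = p then c k q else if x = k ∧ j = q then c i p else c x j

theorem tr_pos {ℓ : ℕ} {c : ZMod ℓ → ℕ → ZMod ℓ} {i : ZMod ℓ} {p : ℕ} {k : ZMod ℓ} {q : ℕ}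
    {x : ZMod ℓ} {j : ℕ} (h1 : j ≠ p) (h2 : j ≠ q) : tr c i p k q x j = c x j := by
  unfold tr; simp [h1, h2]

theorem tr_cyc {ℓ : ℕ} {c : ZMod ℓ → ℕ → ZMod ℓ} {i : ZMod ℓ} {p : ℕ} {k : ZMod ℓ} {q : ℕ}
    {x : ZMod ℓ} {j : ℕ} (h1 : x ≠ i) (h2 : x ≠ k) : tr c i p k q x j = c x j := by
  unfold tr; simp [h1, h2]

theorem tr_l {ℓ : ℕ} {c : ZMod ℓ → ℕ → ZMod ℓ} {i : ZMod ℓ} {p : ℕ} {k : ZMod ℓ} {q : ℕ} :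
    tr c i p k q i p = c k q := by
  unfold tr; simp

theorem tr_r {ℓ : ℕ} {c : ZMod ℓ → ℕ → ZMod ℓ} {i : ZMod ℓ} {p : ℕ} {k : ZMod ℓ} {q : ℕ} (hik : i ≠ k) :
    tr c i p k q k q = c i p := by
  unfold tr; simp [hik.symm]

theorem tr_l' {ℓ : ℕ} {c : ZMod ℓ → ℕ → ZMod ℓ} {i : ZMod ℓ} {p : ℕ} {k : ZMod ℓ} {q : ℕ} {j : ℕ} (hik : i ≠ k)
    (hj : j ≠ p) : tr c i p k q i j = c i j := by
  unfold tr; simp [hik, hj]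

theorem tr_r' {ℓ : ℕ} {c : ZMod ℓ → ℕ → ZMod ℓ} {i : ZMod ℓ} {p : ℕ} {k : ZMod ℓ} {q : ℕ} {j : ℕ} (hik : i ≠ k)
    (hj : j ≠ q) : tr c i p k q k j = c k j := by
  unfold tr; simp [hik.symm, hj]

/-- `j, j+1` on cycle `i` is the edge `a,d` -/
def Eg {ℓ : ℕ} (c : ZMod ℓ → ℕ → ZMod ℓ) (i : ZMod ℓ) (j : ℕ) (a d : ZMod ℓ) : Prop :=
  (j % 2 = 0 ∧ c i j = a ∧ c i (j+1) = d) ∨ (j % 2 = 1 ∧ c i (j+1) = a ∧ c i j = d)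

theorem XPre.trade {ℓ h : ℕ} {e : ZMod ℓ} {c : ZMod ℓ → ℕ → ZMod ℓ} (H : XPre ℓ h e c)
    (i : ZMod ℓ) (p : ℕ) (k : ZMod ℓ) (q : ℕ) (hik : i ≠ k)
    (hpq : p % 2 = q % 2) (hp0 : 0 < p) (hp1 : p + 1 < 2*h) (hq0 : 0 < q) (hq1 : q + 1 < 2*h)
    (hpair : (c i (p-1) = c k (q-1) ∧ c i (p+1) = c k (q+1)) ∨
      (c i (p-1) = c k (q+1) ∧ c i (p+1) = c k (q-1)))
    (h1 : ∀ j, j < 2*h → j % 2 = p % 2 → c i j ≠ c k q)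
    (h2 : ∀ j, j < 2*h → j % 2 = q % 2 → c k j ≠ c i p) :
    XPre ℓ h e (tr c i p k q) := by
  refine ⟨?_, ?_, ?_, ?_⟩
  · intro x; rw [tr_pos (by omega) (by omega)]; exact H.first x
  · intro x; rw [tr_pos (by omega) (by omega)]; exact H.last x
  · intro x j j' hj hj' hpar hE
    by_cases hxi : x = i
    · subst hxi
      by_cases a1 : j = p <;> by_cases a2 : j' = p
      · omega
      · subst a1; rw [tr_l, tr_l' hik a2] at hE
        exact absurd hE.symm (h1 j' hj' (by omega))
      · subst a2; rw [tr_l, tr_l' hik a1] at hE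
        exact absurd hE (h1 j hj (by omega))
      · rw [tr_l' hik a1, tr_l' hik a2] at hE
        exact H.inj x j j' hj hj' hpar hE
    · by_cases hxk : x = k
      · subst hxk
        by_cases a1 : j = q <;> by_cases a2 : j' = q
        · omega
        · subst a1; rw [tr_r hik, tr_r' hik a2] at hE
          exact absurd hE.symm (h2 j' hj' (by omega))
        · subst a2; rw [tr_r hik, tr_r' hik a1] at hE
          exact absurd hE (h2 j hj (by omega))
        · rw [tr_r' hik a1, tr_r' hik a2] at hE
          exact H.inj x j j' hj hj' hpar hE
      · rw [tr_cyc hxi hxk, tr_cyc hxi hxk] at hE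
        exact H.inj x j j' hj hj' hpar hE
  · intro a d ha hd
    obtain ⟨x, j, hj, hc⟩ := H.cov a d ha hd
    obtain ⟨p', rfl⟩ : ∃ p', p = p' + 1 := ⟨p - 1, by omega⟩
    obtain ⟨q', rfl⟩ : ∃ q', q = q' + 1 := ⟨q - 1, by omega⟩
    simp only [Nat.add_sub_cancel] at hpair
    have T1 : tr c i (p'+1) k (q'+1) i (p'+1) = c k (q'+1) := tr_l
    have T2 : tr c i (p'+1) k (q'+1) k (q'+1) = c i (p'+1) := tr_r hik
    have T3 : tr c i (p'+1) k (q'+1) i p' = c i p' := tr_l' hik (by omega)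
    have T4 : tr c i (p'+1) k (q'+1) i (p'+1+1) = c i (p'+1+1) := tr_l' hik (by omega)
    have T5 : tr c i (p'+1) k (q'+1) k q' = c k q' := tr_r' hik (by omega)
    have T6 : tr c i (p'+1) k (q'+1) k (q'+1+1) = c k (q'+1+1) := tr_r' hik (by omega)
    -- the four special edges
    have Q1 : Eg c i p' a d → ∃ i' j', j' + 1 < 2*h ∧ Eg (tr c i (p'+1) k (q'+1)) i' j' a d := by
      intro hg
      rcases hpair with ⟨e1, e2⟩ | ⟨e1, e2⟩
      · refine ⟨k, q', by omega, ?_⟩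
        unfold Eg at *; rw [T2, T5, ← e1]
        rcases hg with hg | hg
        · exact Or.inl ⟨by omega, hg.2⟩
        · exact Or.inr ⟨by omega, hg.2⟩
      · refine ⟨k, q'+1, by omega, ?_⟩
        unfold Eg at *; rw [T2, T6, ← e1]
        rcases hg with hg | hg
        · exact Or.inr ⟨by omega, hg.2⟩
        · exact Or.inl ⟨by omega, hg.2⟩
    have Q2 : Eg c i (p'+1) a d → ∃ i' j', j' + 1 < 2*h ∧ Eg (tr c i (p'+1) k (q'+1)) i' j' a d := by
      intro hg
      rcases hpair with ⟨e1, e2⟩ | ⟨e1, e2⟩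
      · refine ⟨k, q'+1, by omega, ?_⟩
        unfold Eg at *; rw [T2, T6, ← e2]
        rcases hg with hg | hg
        · exact Or.inl ⟨by omega, hg.2⟩
        · exact Or.inr ⟨by omega, hg.2⟩
      · refine ⟨k, q', by omega, ?_⟩
        unfold Eg at *; rw [T2, T5, ← e2]
        rcases hg with hg | hg
        · exact Or.inr ⟨by omega, hg.2⟩
        · exact Or.inl ⟨by omega, hg.2⟩
    have Q3 : Eg c k q' a d → ∃ i' j', j' + 1 < 2*h ∧ Eg (tr c i (p'+1) k (q'+1)) i' j' a d := by
      intro hg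
      rcases hpair with ⟨e1, e2⟩ | ⟨e1, e2⟩
      · refine ⟨i, p', by omega, ?_⟩
        unfold Eg at *; rw [T1, T3, e1]
        rcases hg with hg | hg
        · exact Or.inl ⟨by omega, hg.2⟩
        · exact Or.inr ⟨by omega, hg.2⟩
      · refine ⟨i, p'+1, by omega, ?_⟩
        unfold Eg at *; rw [T1, T4, e2]
        rcases hg with hg | hg
        · exact Or.inr ⟨by omega, hg.2⟩
        · exact Or.inl ⟨by omega, hg.2⟩
    have Q4 : Eg c k (q'+1) a d → ∃ i' j', j' + 1 < 2*h ∧ Eg (tr c i (p'+1) k (q'+1)) i' j' a d := by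
      intro hg
      rcases hpair with ⟨e1, e2⟩ | ⟨e1, e2⟩
      · refine ⟨i, p'+1, by omega, ?_⟩
        unfold Eg at *; rw [T1, T4, e2]
        rcases hg with hg | hg
        · exact Or.inl ⟨by omega, hg.2⟩
        · exact Or.inr ⟨by omega, hg.2⟩
      · refine ⟨i, p', by omega, ?_⟩
        unfold Eg at *; rw [T1, T3, e1]
        rcases hg with hg | hg
        · exact Or.inr ⟨by omega, hg.2⟩
        · exact Or.inl ⟨by omega, hg.2⟩
    by_cases b1 : x = i ∧ j = p'
    · obtain ⟨rfl, rfl⟩ := b1; exact Q1 hc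
    by_cases b2 : x = i ∧ j = p' + 1
    · obtain ⟨rfl, rfl⟩ := b2; exact Q2 hc
    by_cases b3 : x = k ∧ j = q'
    · obtain ⟨rfl, rfl⟩ := b3; exact Q3 hc
    by_cases b4 : x = k ∧ j = q' + 1
    · obtain ⟨rfl, rfl⟩ := b4; exact Q4 hc
    refine ⟨x, j, hj, ?_⟩
    have E1 : tr c i (p'+1) k (q'+1) x j = c x j := by
      unfold tr; rw [if_neg b2, if_neg b4]
    have E2 : tr c i (p'+1) k (q'+1) x (j+1) = c x (j+1) := by
      unfold tr; rw [if_neg (by simpa using b1), if_neg (by simpa using b3)]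
    rw [E1, E2]; exact hc

theorem xcnt_mod {ℓ h : ℕ} {e : ZMod ℓ} {c c' : ZMod ℓ → ℕ → ZMod ℓ} (col : ZMod ℓ → Bool) (i : ZMod ℓ)
    (p : ℕ) (hp : p < 2*h) (hc : ∀ j, j ≠ p → c' i j = c i j) :
    xcnt h e c' col i + rd col (c i p) = xcnt h e c col i + rd col (c' i p) := by
  unfold xcnt
  have hm : p ∈ Finset.range (2*h) := Finset.mem_range.mpr hp
  rw [← Finset.add_sum_erase _ _ hm, ← Finset.add_sum_erase (Finset.range (2*h)) (fun j => rd col (c i j)) hm]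
  have : ∑ x ∈ (Finset.range (2*h)).erase p, rd col (c' i x) = ∑ x ∈ (Finset.range (2*h)).erase p, rd col (c i x) := by
    apply Finset.sum_congr rfl
    intro j hj
    rw [hc j (Finset.ne_of_mem_erase hj)]
  rw [this]; ring

theorem xcnt_l {ℓ h : ℕ} {e : ZMod ℓ} {c : ZMod ℓ → ℕ → ZMod ℓ} (col : ZMod ℓ → Bool) {i : ZMod ℓ}
    {p : ℕ} {k : ZMod ℓ} {q : ℕ} (hik : i ≠ k) (hp : p < 2*h) :
    xcnt h e (tr c i p k q) col i + rd col (c i p) = xcnt h e c col i + rd col (c k q) := by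
  rw [xcnt_mod col i p hp (fun j hj => tr_l' hik hj), tr_l]

theorem xcnt_r {ℓ h : ℕ} {e : ZMod ℓ} {c : ZMod ℓ → ℕ → ZMod ℓ} (col : ZMod ℓ → Bool) {i : ZMod ℓ}
    {p : ℕ} {k : ZMod ℓ} {q : ℕ} (hik : i ≠ k) (hq : q < 2*h) :
    xcnt h e (tr c i p k q) col k + rd col (c k q) = xcnt h e c col k + rd col (c i p) := by
  rw [xcnt_mod col k q hq (fun j hj => tr_r' hik hj), tr_r hik]

theorem xcnt_o {ℓ h : ℕ} {e : ZMod ℓ} {c : ZMod ℓ → ℕ → ZMod ℓ} (col : ZMod ℓ → Bool) {i : ZMod ℓ}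
    {p : ℕ} {k : ZMod ℓ} {q : ℕ} {x : ZMod ℓ} (h1 : x ≠ i) (h2 : x ≠ k) :
    xcnt h e (tr c i p k q) col x = xcnt h e c col x := by
  unfold xcnt
  simp only [tr_cyc h1 h2]

/-- sums over integer intervals -/
def SS (f : ℤ → ℕ) (a : ℤ) (n : ℕ) : ℕ := ∑ j ∈ Finset.range n, f (a + j)

theorem SS_one (f : ℤ → ℕ) (a : ℤ) : SS f a 1 = f a := by simp [SS]

theorem SS_glue (f : ℤ → ℕ) {a b : ℤ} {n m k : ℕ} (hb : b = a + n) (hk : k = n + m) :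
    SS f a n + SS f b m = SS f a k := by
  subst hb hk
  unfold SS
  rw [Finset.sum_range_add]
  congr 1
  apply Finset.sum_congr rfl
  intro j _
  push_cast; congr 1; ring

theorem SS_const (f : ℤ → ℕ) (a : ℤ) (n v : ℕ) (h : ∀ x : ℤ, a ≤ x → x < a + n → f x = v) :
    SS f a n = n * v := by
  unfold SS
  rw [Finset.sum_congr rfl (g := fun _ => v)]
  · simp
  · intro j hj
    rw [Finset.mem_range] at hj
    exact h _ (by omega) (by omega)

theorem SS_shift (f : ℤ → ℕ) (L : ℕ) (hf : ∀ x, f (x + L) = f x) (a : ℤ) : SS f (a+1) L = SS f a L := by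
  have h1 : SS f a 1 + SS f (a+1) L = SS f a (L+1) := SS_glue f (by simp) (by omega)
  have h2 : SS f a L + SS f (a+L) 1 = SS f a (L+1) := SS_glue f rfl rfl
  rw [SS_one] at h1 h2
  rw [hf] at h2
  omega

theorem SS_period (f : ℤ → ℕ) (L : ℕ) (hf : ∀ x, f (x + L) = f x) (a : ℤ) : SS f a L = SS f 0 L := by
  induction a with
  | zero => rfl
  | succ n ih => rw [← ih]; exact SS_shift f L hf n
  | pred n ih => rw [← ih, ← SS_shift f L hf]; congr 1; ring

theorem sum_up (f : ℤ → ℕ) (G : ℕ → ℕ) {n m k : ℕ} (a : ℤ) (hk : k = n + m)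
    (h : ∀ j, j < m → G (n + j) = f (a + j)) :
    ∑ j ∈ Finset.range k, G j = ∑ j ∈ Finset.range n, G j + SS f a m := by
  subst hk
  rw [Finset.sum_range_add]
  congr 1
  apply Finset.sum_congr rfl
  intro j hj
  exact h j (Finset.mem_range.mp hj)

theorem sum_down (f : ℤ → ℕ) (G : ℕ → ℕ) {n m k : ℕ} (a : ℤ) (hk : k = n + m)
    (h : ∀ j, j < m → G (n + j) = f (a + m - 1 - j)) :
    ∑ j ∈ Finset.range k, G j = ∑ j ∈ Finset.range n, G j + SS f a m := by
  subst hk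
  rw [Finset.sum_range_add]
  congr 1
  unfold SS
  rw [← Finset.sum_range_reflect]
  apply Finset.sum_congr rfl
  intro j hj
  have hj := Finset.mem_range.mp hj
  rw [h _ (by omega)]
  congr 1
  omega

theorem sum_pairs (G : ℕ → ℕ) (h : ℕ) : ∑ j ∈ Finset.range (2*h), G j =
    ∑ t ∈ Finset.range h, G (2*t) + ∑ t ∈ Finset.range h, G (2*t+1) := by
  induction h with
  | zero => simp
  | succ n ih =>
    rw [show 2*(n+1) = 2*n+1+1 by ring, Finset.sum_range_succ, Finset.sum_range_succ, ih,
      Finset.sum_range_succ, Finset.sum_range_succ]; ring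

/-- colouring given by a predicate on representatives -/
noncomputable def colR (ℓ : ℕ) (R : ℤ → Prop) (x : ZMod ℓ) : Bool := by
  classical exact decide (R (x.val : ℤ))

theorem colR_spec {ℓ : ℕ} [NeZero ℓ] (R : ℤ → Prop) (x : ℤ) (h1 : -ℓ ≤ x) (h2 : x < 2*ℓ) :
    ∃ y : ℤ, 0 ≤ y ∧ y < ℓ ∧ (x = y ∨ x = y + ℓ ∨ x = y - ℓ) ∧
    ((R y ∧ rd (colR ℓ R) ((x : ℤ) : ZMod ℓ) = 1) ∨ (¬ R y ∧ rd (colR ℓ R) ((x : ℤ) : ZMod ℓ) = 0)) := by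
  classical
  have key : ∀ y : ℤ, 0 ≤ y → y < ℓ → ((x : ℤ) : ZMod ℓ) = ((y : ℤ) : ZMod ℓ) →
    ((R y ∧ rd (colR ℓ R) ((x : ℤ) : ZMod ℓ) = 1) ∨ (¬ R y ∧ rd (colR ℓ R) ((x : ℤ) : ZMod ℓ) = 0)) := by
    intro y a1 a2 a3
    rw [a3]
    have hv : ((((y : ℤ) : ZMod ℓ).val : ℕ) : ℤ) = y := by
      rw [ZMod.val_intCast, Int.emod_eq_of_lt a1 a2]
    unfold rd colR
    rw [hv]
    by_cases hR : R y
    · left; simp [hR]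
    · right; simp [hR]
  by_cases c1 : x < 0
  · exact ⟨x + ℓ, by omega, by omega, by omega, key _ (by omega) (by omega) (zc_intro (-1) (by ring))⟩
  · by_cases c2 : x < ℓ
    · exact ⟨x, by omega, by omega, by omega, key _ (by omega) (by omega) rfl⟩
    · exact ⟨x - ℓ, by omega, by omega, by omega, key _ (by omega) (by omega) (zc_intro 1 (by ring))⟩

theorem rd_period {ℓ : ℕ} (col : ZMod ℓ → Bool) (x : ℤ) :
    rd col (((x + (ℓ : ℕ) : ℤ)) : ZMod ℓ) = rd col ((x : ℤ) : ZMod ℓ) := by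
  rw [zc_intro (ℓ := ℓ) (x := x + (ℓ : ℕ)) (y := x) 1 (by ring)]

theorem SS_total {ℓ : ℕ} [NeZero ℓ] (col : ZMod ℓ → Bool) :
    ∑ x, rd col x = SS (fun x => rd col ((x : ℤ) : ZMod ℓ)) 0 ℓ := by
  have := sum_zmod (ℓ := ℓ) (fun n => rd col ((n : ℕ) : ZMod ℓ))
  unfold SS
  simpa using this

def pA (g : ℕ) (j : ℕ) : ℤ :=
  if j % 2 = 0 then (if j ≤ 2*g then -((j:ℤ)/2) else (4*(g:ℤ)+4-j)/2)
  else if j < 2*g then ((j:ℤ) - 1 - (4*g+2))/2 else if j < 4*g+3 then ((j:ℤ)+1)/2 else 0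

theorem pA_spec (g j : ℕ) (hj : j < 4*g+4) :
    (j % 2 = 0 ∧ j ≤ 2*g ∧ 2 * pA g j = -j) ∨ (j % 2 = 0 ∧ 2*g+2 ≤ j ∧ 2 * pA g j = 4*g+4-j) ∨
    (j % 2 = 1 ∧ j < 2*g ∧ 2 * pA g j = j - 1 - (4*g+2)) ∨
    (j % 2 = 1 ∧ 2*g+1 ≤ j ∧ j < 4*g+3 ∧ 2 * pA g j = j + 1) ∨ (j = 4*g+3 ∧ pA g j = 0) := by
  unfold pA
  split_ifs <;> omega

def RA (g : ℕ) (y : ℤ) : Prop := y = 0 ∨ (g + 2 ≤ y ∧ y ≤ 2*g+2) ∨ 3*g+5 ≤ y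

theorem A_pre (g : ℕ) : XPre (4*g+5) (2*g+2) (((2*g+2 : ℤ)) : ZMod (4*g+5)) (cb (pA g)) := by
  apply XPre_base (by ring)
  · have := pA_spec g 0 (by omega); omega
  · have := pA_spec g (2*(2*g+2)-1) (by omega); omega
  · intro j hj
    have := pA_spec g j (by omega); push_cast; omega
  · intro j j' hj hj' hp hE
    have h1 := pA_spec g j (by omega)
    have h2 := pA_spec g j' (by omega)
    push_cast at hE
    rcases h1 with h1 | h1 | h1 | h1 | h1 <;> rcases h2 with h2 | h2 | h2 | h2 | h2 <;> omega
  · intro d h1 h2 h3 h4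
    push_cast at h1 h2
    have hd : d = 2*g+1 ∨ d = -1 ∨ ((0 ≤ d + (2*g+1)) ∧ d + (2*g+1) < 4*g+2 ∧ d ≠ -1) := by omega
    rcases hd with hd | hd | hd
    · refine ⟨2*g, by omega, 0, Or.inl ⟨by omega, ?_⟩⟩
      have a1 := pA_spec g (2*g) (by omega)
      have a2 := pA_spec g (2*g+1) (by omega)
      omega
    · refine ⟨4*g+2, by omega, 0, Or.inl ⟨by omega, ?_⟩⟩
      have a1 := pA_spec g (4*g+2) (by omega)
      have a2 := pA_spec g (4*g+2+1) (by omega)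
      omega
    · obtain ⟨J, hJ⟩ := Int.eq_ofNat_of_zero_le hd.1
      refine ⟨J, by omega, 0, ?_⟩
      have a1 := pA_spec g J (by omega)
      have a2 := pA_spec g (J+1) (by omega)
      push_cast at a2
      omega

theorem A_total (g : ℕ) : SS (fun x => rd (colR (4*g+5) (RA g)) ((x : ℤ) : ZMod (4*g+5))) 0 (4*g+5) = 2*g+2 := by
  set f : ℤ → ℕ := fun x => rd (colR (4*g+5) (RA g)) ((x : ℤ) : ZMod (4*g+5)) with hf
  have sp : ∀ x : ℤ, 0 ≤ x → x < 4*g+5 → (RA g x ∧ f x = 1) ∨ (¬ RA g x ∧ f x = 0) := by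
    intro x h1 h2
    obtain ⟨y, a, b, c, d⟩ := colR_spec (ℓ := 4*g+5) (RA g) x (by omega) (by omega)
    have : y = x := by push_cast at *; omega
    rwa [this] at d
  have s1 : SS f 0 1 = 1 * 1 := SS_const _ _ _ _ (fun x h1 h2 => by
    have := sp x (by omega) (by omega); unfold RA at this; omega)
  have s2 : SS f 1 (g+1) = (g+1) * 0 := SS_const _ _ _ _ (fun x h1 h2 => by
    have := sp x (by omega) (by omega); unfold RA at this; omega)
  have s3 : SS f (g+2) (g+1) = (g+1) * 1 := SS_const _ _ _ _ (fun x h1 h2 => by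
    have := sp x (by omega) (by omega); unfold RA at this; omega)
  have s4 : SS f (2*g+3) (g+2) = (g+2) * 0 := SS_const _ _ _ _ (fun x h1 h2 => by
    have := sp x (by omega) (by omega); unfold RA at this; omega)
  have s5 : SS f (3*g+5) g = g * 1 := SS_const _ _ _ _ (fun x h1 h2 => by
    have := sp x (by omega) (by omega); unfold RA at this; omega)
  have g1 : SS f 0 1 + SS f 1 (g+1) = SS f 0 (g+2) := SS_glue f (by omega) (by omega)
  have g2 : SS f 0 (g+2) + SS f (g+2) (g+1) = SS f 0 (2*g+3) := SS_glue f (by omega) (by omega)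
  have g3 : SS f 0 (2*g+3) + SS f (2*g+3) (g+2) = SS f 0 (3*g+5) := SS_glue f (by omega) (by omega)
  have g4 : SS f 0 (3*g+5) + SS f (3*g+5) g = SS f 0 (4*g+5) := SS_glue f (by omega) (by omega)
  omega

theorem A_cnt (g : ℕ) (n : ℤ) (f : ℤ → ℕ)
    (hf : f = fun x => rd (colR (4*g+5) (RA g)) ((x : ℤ) : ZMod (4*g+5))) :
    xcnt (2*g+2) (((2*g+2 : ℤ)) : ZMod (4*g+5)) (cb (pA g)) (colR (4*g+5) (RA g)) ((n : ℤ) : ZMod (4*g+5))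
      + f (n - 2*g - 2) + f (n - g - 1) = 2*g+2 + f n + f (n+g+1) := by
  have hper : ∀ x, f (x + (4*g+5 : ℕ)) = f x := by intro x; rw [hf]; exact rd_period _ x
  have htot : SS f (n - 2*g - 2) (4*g+5) = 2*g+2 := by
    rw [SS_period f _ hper, hf]; exact A_total g
  unfold xcnt
  have hA : rd (colR (4*g+5) (RA g)) (((n : ℤ) : ZMod (4*g+5)) + (((2*g+2 : ℤ)) : ZMod (4*g+5))) = f (n+2*g+2) := by
    rw [hf]; beta_reduce; congr 1; push_cast; ring
  have hG : ∀ j, rd (colR (4*g+5) (RA g)) (cb (pA g) ((n : ℤ) : ZMod (4*g+5)) j) = f (n + pA g j) := by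
    intro j; rw [cb_int, hf]
  rw [hA]
  simp only [hG]
  rw [sum_pairs (fun j => f (n + pA g j))]
  rw [sum_down f (fun t => f (n + pA g (2*t))) (n := g+1) (m := g+1) (n+1) (by omega) (by
    intro j hj
    have := pA_spec g (2*(g+1+j)) (by omega)
    congr 1; push_cast at *; omega)]
  rw [sum_down f (fun t => f (n + pA g (2*t))) (n := 0) (m := g+1) (n-g) (by omega) (by
    intro j hj
    have := pA_spec g (2*(0+j)) (by omega)
    congr 1; push_cast at *; omega)]
  rw [sum_up f (fun t => f (n + pA g (2*t+1))) (n := 2*g+1) (m := 1) n (by omega) (by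
    intro j hj
    have := pA_spec g (2*(2*g+1+j)+1) (by omega)
    congr 1; push_cast at *; omega)]
  rw [sum_up f (fun t => f (n + pA g (2*t+1))) (n := g) (m := g+1) (n+g+1) (by omega) (by
    intro j hj
    have := pA_spec g (2*(g+j)+1) (by omega)
    congr 1; push_cast at *; omega)]
  rw [sum_up f (fun t => f (n + pA g (2*t+1))) (n := 0) (m := g) (n-2*g-1) (by omega) (by
    intro j hj
    have := pA_spec g (2*(0+j)+1) (by omega)
    congr 1; push_cast at *; omega)]
  simp only [Finset.range_zero, Finset.sum_empty]
  have g1 : SS f (n-2*g-2) 1 + SS f (n-2*g-1) g = SS f (n-2*g-2) (g+1) := SS_glue f (by omega) (by omega)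
  have g2 : SS f (n-2*g-2) (g+1) + SS f (n-g-1) 1 = SS f (n-2*g-2) (g+2) := SS_glue f (by omega) (by omega)
  have g3 : SS f (n-2*g-2) (g+2) + SS f (n-g) (g+1) = SS f (n-2*g-2) (2*g+3) := SS_glue f (by omega) (by omega)
  have g4 : SS f (n-2*g-2) (2*g+3) + SS f (n+1) (g+1) = SS f (n-2*g-2) (3*g+4) := SS_glue f (by omega) (by omega)
  have g5 : SS f (n+g+1) 1 + SS f (n+g+2) g = SS f (n+g+1) (g+1) := SS_glue f (by omega) (by omega)
  have g6 : SS f (n-2*g-2) (3*g+4) + SS f (n+g+2) g = SS f (n-2*g-2) (4*g+4) := SS_glue f (by omega) (by omega)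
  have g7 : SS f (n-2*g-2) (4*g+4) + SS f (n+2*g+2) 1 = SS f (n-2*g-2) (4*g+5) := SS_glue f (by omega) (by omega)
  simp only [SS_one] at *
  omega

theorem A_base (g : ℕ) (n : ℤ) (hn1 : 0 ≤ n) (hn2 : n < 4*g+5) : ∃ N, N = xcnt (2*g+2) (((2*g+2 : ℤ)) : ZMod (4*g+5)) (cb (pA g)) (colR (4*g+5) (RA g)) ((n : ℤ) : ZMod (4*g+5)) ∧
      (n = 0 ∧ N = 2*g+3 ∨ n = 2*g+3 ∧ N + 1 = 2*g+2 ∨ n ≠ 0 ∧ n ≠ 2*g+3 ∧ (N = 2*g+2)) := by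
  refine ⟨_, rfl, ?_⟩
  have sp := colR_spec (ℓ := 4*g+5) (RA g)
  have hc := A_cnt g n _ rfl
  obtain ⟨y1, a1, b1, c1, d1⟩ := sp (n - 2*g - 2) (by push_cast; omega) (by push_cast; omega)
  obtain ⟨y2, a2, b2, c2, d2⟩ := sp (n - g - 1) (by push_cast; omega) (by push_cast; omega)
  obtain ⟨y3, a3, b3, c3, d3⟩ := sp n (by push_cast; omega) (by push_cast; omega)
  obtain ⟨y4, a4, b4, c4, d4⟩ := sp (n + g + 1) (by push_cast; omega) (by push_cast; omega)
  beta_reduce at hc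
  generalize xcnt (2*g+2) (((2*g+2 : ℤ)) : ZMod (4*g+5)) (cb (pA g)) (colR (4*g+5) (RA g)) ((n : ℤ) : ZMod (4*g+5)) = N at *
  generalize rd (colR (4*g+5) (RA g)) (((n - 2*g - 2 : ℤ)) : ZMod (4*g+5)) = r1 at *
  generalize rd (colR (4*g+5) (RA g)) (((n - g - 1 : ℤ)) : ZMod (4*g+5)) = r2 at *
  generalize rd (colR (4*g+5) (RA g)) (((n : ℤ)) : ZMod (4*g+5)) = r3 at *
  generalize rd (colR (4*g+5) (RA g)) (((n + g + 1 : ℤ)) : ZMod (4*g+5)) = r4 at *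
  clear sp
  unfold RA at d1 d2 d3 d4
  push_cast at b1 b2 b3 b4 c1 c2 c3 c4
  have q3 : y3 = n := by omega
  subst q3
  clear c3
  have q1 : (y1 = y3 - 2*g-2 ∧ 2*g+2 ≤ y3) ∨ (y1 = y3 + 2*g + 3 ∧ y3 < 2*g+2) := by omega
  have q2 : (y2 = y3 - g-1 ∧ g+1 ≤ y3) ∨ (y2 = y3 + 3*g + 4 ∧ y3 < g+1) := by omega
  have q4 : (y4 = y3 + g+1 ∧ y3 < 3*g+4) ∨ (y4 = y3 - 3*g - 4 ∧ 3*g+4 ≤ y3) := by omega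
  clear c1 c2 c4
  rcases q1 with ⟨rfl, u1⟩ | ⟨rfl, u1⟩ <;> rcases q2 with ⟨rfl, u2⟩ | ⟨rfl, u2⟩ <;>
    rcases q4 with ⟨rfl, u4⟩ | ⟨rfl, u4⟩ <;> first | (exfalso; clear d1 d2 d3 d4; omega) |
    (rcases d1 with ⟨d1, rfl⟩ | ⟨d1, rfl⟩ <;> rcases d2 with ⟨d2, rfl⟩ | ⟨d2, rfl⟩ <;> first | (exfalso; clear d3 d4; omega) |
     (rcases d3 with ⟨d3, rfl⟩ | ⟨d3, rfl⟩ <;> rcases d4 with ⟨d4, rfl⟩ | ⟨d4, rfl⟩ <;> omega))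

theorem pA_even (g j : ℕ) (hj : j < 4*g+4) (h : j % 2 = 0) : -g ≤ pA g j ∧ pA g j ≤ g+1 := by
  have := pA_spec g j hj
  omega

theorem pA_odd (g j : ℕ) (hj : j < 4*g+4) (h : j % 2 = 1) : (-2*g-1 ≤ pA g j ∧ pA g j ≤ -g-2) ∨
    (g+1 ≤ pA g j ∧ pA g j ≤ 2*g+1) ∨ pA g j = 0 := by
  have := pA_spec g j hj
  omega

theorem zc_ne {ℓ : ℕ} {x y : ℤ} (h1 : x - y < 3 * ℓ) (h2 : y - x < 3 * ℓ) (a0 : x ≠ y) (a1 : x ≠ y + ℓ)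
    (a2 : x ≠ y - ℓ) (a3 : x ≠ y + 2*ℓ) (a4 : x ≠ y - 2*ℓ) : ((x : ℤ) : ZMod ℓ) ≠ ((y : ℤ) : ZMod ℓ) := by
  intro h
  have := zc_elim h h1 h2
  omega

theorem pA_v1 (g j : ℕ) (h : j % 2 = 0) (h' : j ≤ 2*g) : 2 * pA g j = -j := by
  have := pA_spec g j (by omega); omega

theorem pA_v2 (g j : ℕ) (h : j % 2 = 0) (h' : 2*g+2 ≤ j) (h'' : j < 4*g+4) : 2 * pA g j = 4*g+4-j := by
  have := pA_spec g j (by omega); omega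

theorem pA_v3 (g j : ℕ) (h : j % 2 = 1) (h' : j < 2*g) : 2 * pA g j = j - 1 - (4*g+2) := by
  have := pA_spec g j (by omega); omega

theorem pA_v4 (g j : ℕ) (h : j % 2 = 1) (h' : 2*g+1 ≤ j) (h'' : j < 4*g+3) : 2 * pA g j = j + 1 := by
  have := pA_spec g j (by omega); omega

theorem A_base' (g : ℕ) (i : ZMod (4*g+5)) (n : ℤ) (hn : i = ((n : ℤ) : ZMod (4*g+5))) (hn1 : 0 ≤ n) (hn2 : n < 4*g+5) (h0 : n ≠ 0) (h1 : n ≠ 2*g+3) :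
    xcnt (2*g+2) (((2*g+2 : ℤ)) : ZMod (4*g+5)) (cb (pA g)) (colR (4*g+5) (RA g)) i = 2*g+2 := by
  obtain ⟨N, h, h'⟩ := A_base g n hn1 hn2
  rw [hn, ← h]; omega

set_option maxHeartbeats 2000000 in
theorem A_ok (g k : ℕ) (h1 : g + 3 ≤ 3*k) (h2 : 2*k ≤ g+1) (h3 : 2 ≤ k) : XOk (4*g+5) (2*g+2) := by
  set f : ℤ → ℕ := fun x => rd (colR (4*g+5) (RA g)) ((x : ℤ) : ZMod (4*g+5)) with hf
  have H0 := A_pre g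
  have N1 : ∀ z : ℤ, -g ≤ z → z ≤ g+1 → ((2*g+3+z : ℤ) : ZMod (4*g+5)) ≠ ((k+(k-g-1) : ℤ) : ZMod (4*g+5)) := by
    intro z a b; apply zc_ne <;> push_cast <;> omega
  have N2 : ∀ z : ℤ, -g ≤ z → z ≤ g+1 → ((k+z : ℤ) : ZMod (4*g+5)) ≠ ((2*g+3+(g+1) : ℤ) : ZMod (4*g+5)) := by
    intro z a b; apply zc_ne <;> push_cast <;> omega
  have N3 : ∀ z : ℤ, (-2*g-1 ≤ z ∧ z ≤ -g-2) ∨ (g+1 ≤ z ∧ z ≤ 2*g+1) ∨ z = 0 →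
      ((k+z : ℤ) : ZMod (4*g+5)) ≠ ((0+(2*g+3-2*k) : ℤ) : ZMod (4*g+5)) := by
    intro z a; apply zc_ne <;> push_cast <;> omega
  have N4 : ∀ z : ℤ, (-2*g-1 ≤ z ∧ z ≤ -g-2) ∨ (g+1 ≤ z ∧ z ≤ 2*g+1) ∨ z = 0 →
      ((0+z : ℤ) : ZMod (4*g+5)) ≠ ((k+(2*g+3-k) : ℤ) : ZMod (4*g+5)) := by
    intro z a; apply zc_ne <;> push_cast <;> omega
  obtain ⟨p1, hp1⟩ : ∃ p1, p1 = 2*g+2 := ⟨_, rfl⟩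
  obtain ⟨q1, hq1⟩ : ∃ q1, q1 + 2*k = 2*g+2 := ⟨2*(g+1-k), by omega⟩
  obtain ⟨p2, hp2⟩ : ∃ p2, p2 + 2*k = 4*g+5 := ⟨4*g+5-2*k, by omega⟩
  obtain ⟨q2, hq2⟩ : ∃ q2, q2 + 4*k = 4*g+5 := ⟨4*g+5-4*k, by omega⟩
  have P1 : pA g p1 = g+1 := by
    have := pA_v2 g p1 (by omega) (by omega) (by omega)
    omega
  have P1m : pA g (p1-1) = g+1 := by
    have := pA_v4 g (p1-1) (by omega) (by omega) (by omega)
    omega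
  have P1p : pA g (p1+1) = g+2 := by
    have := pA_v4 g (p1+1) (by omega) (by omega) (by omega)
    omega
  have Q1 : pA g q1 = k-g-1 := by
    have := pA_v1 g q1 (by omega) (by omega)
    omega
  have Q1m : pA g (q1-1) = -g-k-1 := by
    have := pA_v3 g (q1-1) (by omega) (by omega)
    omega
  have Q1p : pA g (q1+1) = -g-k := by
    have := pA_v3 g (q1+1) (by omega) (by omega)
    omega
  have P2 : pA g p2 = 2*g+3-k := by
    have := pA_v4 g p2 (by omega) (by omega) (by omega)
    omega
  have P2m : pA g (p2-1) = k := by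
    have := pA_v2 g (p2-1) (by omega) (by omega) (by omega)
    omega
  have P2p : pA g (p2+1) = k-1 := by
    have := pA_v2 g (p2+1) (by omega) (by omega) (by omega)
    omega
  have Q2 : pA g q2 = 2*g+3-2*k := by
    have := pA_v4 g q2 (by omega) (by omega) (by omega)
    omega
  have Q2m : pA g (q2-1) = 2*k := by
    have := pA_v2 g (q2-1) (by omega) (by omega) (by omega)
    omega
  have Q2p : pA g (q2+1) = 2*k-1 := by
    have := pA_v2 g (q2+1) (by omega) (by omega) (by omega)
    omega
  obtain ⟨I, hI⟩ : ∃ I : ZMod (4*g+5), I = ((2*g+3 : ℤ) : ZMod (4*g+5)) := ⟨_, rfl⟩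
  obtain ⟨K, hK⟩ : ∃ K : ZMod (4*g+5), K = ((k : ℤ) : ZMod (4*g+5)) := ⟨_, rfl⟩
  obtain ⟨Z, hZ⟩ : ∃ Z : ZMod (4*g+5), Z = ((0 : ℤ) : ZMod (4*g+5)) := ⟨_, rfl⟩
  have nIK : I ≠ K := by
    intro h; rw [hI, hK] at h
    have := zc_elim h (by push_cast; omega) (by push_cast; omega); push_cast at this; omega
  have nIZ : I ≠ Z := by
    intro h; rw [hI, hZ] at h
    have := zc_elim h (by push_cast; omega) (by push_cast; omega); push_cast at this; omega
  have nKZ : K ≠ Z := by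
    intro h; rw [hK, hZ] at h
    have := zc_elim h (by push_cast; omega) (by push_cast; omega); push_cast at this; omega
  have H1 := H0.trade I p1 K q1 nIK (by omega) (by omega) (by omega) (by omega) (by omega)
    (by
      left; rw [hI, hK, cb_int, cb_int, cb_int, cb_int, P1m, P1p, Q1m, Q1p]
      constructor
      · exact zc_intro 1 (by push_cast; omega)
      · exact zc_intro 1 (by push_cast; omega))
    (by
      intro j hj hjp hE
      rw [hI, hK, cb_int, cb_int, Q1] at hE
      have w := pA_even g j (by omega) (by omega)
      exact N1 _ w.1 w.2 hE)
    (by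
      intro j hj hjp hE
      rw [hI, hK, cb_int, cb_int, P1] at hE
      have w := pA_even g j (by omega) (by omega)
      exact N2 _ w.1 w.2 hE)
  have tK : ∀ j, j ≠ q1 → tr (cb (pA g)) I p1 K q1 K j = cb (pA g) K j := fun j hj => tr_r' nIK hj
  have tZ : ∀ j, tr (cb (pA g)) I p1 K q1 Z j = cb (pA g) Z j := fun j => tr_cyc nIZ.symm nKZ.symm
  have H2 := H1.trade K p2 Z q2 nKZ (by omega) (by omega) (by omega) (by omega) (by omega)
    (by
      rw [tK _ (by omega), tK _ (by omega), tZ, tZ]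
      left; rw [hZ, hK, cb_int, cb_int, cb_int, cb_int, P2m, P2p, Q2m, Q2p]
      constructor
      · exact zc_intro 0 (by push_cast; omega)
      · exact zc_intro 0 (by push_cast; omega))
    (by
      intro j hj hjp hE
      rw [tK _ (by omega), tZ] at hE
      rw [hZ, hK, cb_int, cb_int, Q2] at hE
      have w := pA_odd g j (by omega) (by omega)
      exact N3 _ w hE)
    (by
      intro j hj hjp hE
      rw [tK _ (by omega), tZ] at hE
      rw [hZ, hK, cb_int, cb_int, P2] at hE
      have w := pA_odd g j (by omega) (by omega)
      exact N4 _ w hE)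
  refine ⟨colR (4*g+5) (RA g), _, _, H2, (SS_total _).trans (A_total g), ?_⟩
  have sp := colR_spec (ℓ := 4*g+5) (RA g)
  have e1 : rd (colR (4*g+5) (RA g)) (cb (pA g) I p1) = 0 := by
    rw [hI, cb_int, P1]
    clear P1 P1m P1p Q1 Q1m Q1p P2 P2m P2p Q2 Q2m Q2p
    obtain ⟨y, a1, a2, a3, a4⟩ := sp (2*g+3 + (g+1)) (by push_cast; omega) (by push_cast; omega)
    rcases a4 with ⟨a4, a5⟩ | ⟨a4, a5⟩ <;> first | exact a5 | (exfalso; unfold RA at a4; push_cast at a2 a3; clear a5; omega)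
  have e2 : rd (colR (4*g+5) (RA g)) (cb (pA g) K q1) = 1 := by
    rw [hK, cb_int, Q1]
    clear P1 P1m P1p Q1 Q1m Q1p P2 P2m P2p Q2 Q2m Q2p
    obtain ⟨y, a1, a2, a3, a4⟩ := sp (k + (k-g-1)) (by push_cast; omega) (by push_cast; omega)
    rcases a4 with ⟨a4, a5⟩ | ⟨a4, a5⟩ <;> first | exact a5 | (exfalso; unfold RA at a4; push_cast at a2 a3; clear a5; omega)
  have e3 : rd (colR (4*g+5) (RA g)) (cb (pA g) K p2) = 0 := by
    rw [hK, cb_int, P2]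
    clear P1 P1m P1p Q1 Q1m Q1p P2 P2m P2p Q2 Q2m Q2p
    obtain ⟨y, a1, a2, a3, a4⟩ := sp (k + (2*g+3-k)) (by push_cast; omega) (by push_cast; omega)
    rcases a4 with ⟨a4, a5⟩ | ⟨a4, a5⟩ <;> first | exact a5 | (exfalso; unfold RA at a4; push_cast at a2 a3; clear a5; omega)
  have e4 : rd (colR (4*g+5) (RA g)) (cb (pA g) Z q2) = 1 := by
    rw [hZ, cb_int, Q2]
    clear P1 P1m P1p Q1 Q1m Q1p P2 P2m P2p Q2 Q2m Q2p
    obtain ⟨y, a1, a2, a3, a4⟩ := sp (0 + (2*g+3-2*k)) (by push_cast; omega) (by push_cast; omega)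
    rcases a4 with ⟨a4, a5⟩ | ⟨a4, a5⟩ <;> first | exact a5 | (exfalso; unfold RA at a4; push_cast at a2 a3; clear a5; omega)
  have t3 : tr (cb (pA g)) I p1 K q1 K p2 = cb (pA g) K p2 := tK _ (by omega)
  have t4 : tr (cb (pA g)) I p1 K q1 Z q2 = cb (pA g) Z q2 := tZ _
  clear N1 N2 N3 N4 P1 P1m P1p Q1 Q1m Q1p P2 P2m P2p Q2 Q2m Q2p tK tZ
  intro i
  have B1 : xcnt (2*g+2) (((2*g+2 : ℤ)) : ZMod (4*g+5)) (cb (pA g)) (colR (4*g+5) (RA g)) I + 1 = 2*g+2 := by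
    obtain ⟨N, h, h'⟩ := A_base g (2*g+3) (by omega) (by omega)
    rw [hI, ← h]; omega
  have B2 := A_base' g K k hK (by omega) (by omega) (by omega) (by omega)
  have B3 : xcnt (2*g+2) (((2*g+2 : ℤ)) : ZMod (4*g+5)) (cb (pA g)) (colR (4*g+5) (RA g)) Z = 2*g+3 := by
    obtain ⟨N, h, h'⟩ := A_base g 0 (by omega) (by omega)
    rw [hZ, ← h]; omega
  by_cases iI : i = I
  · subst iI
    rw [xcnt_o _ nIK nIZ]
    have := xcnt_l (h := 2*g+2) (e := (((2*g+2 : ℤ)) : ZMod (4*g+5))) (c := cb (pA g)) (colR (4*g+5) (RA g)) (p := p1) (q := q1) nIK (by omega)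
    omega
  by_cases iK : i = K
  · subst iK
    have a := xcnt_l (h := 2*g+2) (e := (((2*g+2 : ℤ)) : ZMod (4*g+5))) (c := tr (cb (pA g)) I p1 i q1) (colR (4*g+5) (RA g)) (p := p2) (q := q2) nKZ (by omega)
    have b := xcnt_r (h := 2*g+2) (e := (((2*g+2 : ℤ)) : ZMod (4*g+5))) (c := cb (pA g)) (colR (4*g+5) (RA g)) (p := p1) (q := q1) nIK (by omega)
    rw [t3, t4] at a
    omega
  by_cases iZ : i = Z
  · subst iZ
    have a := xcnt_r (h := 2*g+2) (e := (((2*g+2 : ℤ)) : ZMod (4*g+5))) (c := tr (cb (pA g)) I p1 K q1) (colR (4*g+5) (RA g)) (p := p2) (q := q2) nKZ (by omega)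
    rw [xcnt_o (c := cb (pA g)) _ iI iK] at a
    rw [t3, t4] at a
    omega
  rw [xcnt_o _ iK iZ, xcnt_o _ iI iK]
  obtain ⟨n, hn0, hn1, hn⟩ := zc_rep i
  have c1 : n ≠ 0 := by rintro rfl; exact iZ (hn.trans hZ.symm)
  have c2 : n ≠ 2*g+3 := by rintro rfl; exact iI (hn.trans hI.symm)
  exact Or.inl (A_base' g i n hn hn0 (by push_cast at hn1; omega) c1 c2)

def pB (g : ℕ) (j : ℕ) : ℤ :=
  if j % 2 = 0 then (if j + 4 ≤ 2*g then (j:ℤ)/2 else if j + 6 ≤ 4*g then ((j:ℤ)-4*g)/2 else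
    if j + 4 = 4*g then -(2*g+1) else if j + 2 = 4*g then 2*g+1 else 2*g)
  else if j + 5 ≤ 2*g then (4*(g:ℤ)-5-j)/2 else if j + 5 ≤ 4*g then (-(j:ℤ)-5)/2 else ((j:ℤ)-(4*g+1))/2

theorem pB_v1 (g j : ℕ) (_hg : 9 ≤ g) (h : j % 2 = 0) (h' : j + 4 ≤ 2*g) : 2 * pB g j = j := by
  unfold pB
  rw [if_pos h, if_pos h']; omega

theorem pB_v2 (g j : ℕ) (_hg : 9 ≤ g) (h : j % 2 = 0) (h' : 2*g ≤ j + 2) (h'' : j + 6 ≤ 4*g) : 2 * pB g j = j - 4*g := by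
  unfold pB
  rw [if_pos h, if_neg (by omega), if_pos h'']; omega

theorem pB_v3 (g j : ℕ) (_hg : 9 ≤ g) (h : j + 4 = 4*g) : pB g j = -(2*g+1) := by
  unfold pB
  rw [if_pos (by omega), if_neg (by omega), if_neg (by omega), if_pos h]

theorem pB_v4 (g j : ℕ) (_hg : 9 ≤ g) (h : j + 2 = 4*g) : pB g j = 2*g+1 := by
  unfold pB
  rw [if_pos (by omega), if_neg (by omega), if_neg (by omega), if_neg (by omega), if_pos h]

theorem pB_v5 (g j : ℕ) (_hg : 9 ≤ g) (h : j = 4*g) : pB g j = 2*g := by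
  unfold pB
  rw [if_pos (by omega), if_neg (by omega), if_neg (by omega), if_neg (by omega), if_neg (by omega)]

theorem pB_v6 (g j : ℕ) (_hg : 9 ≤ g) (h : j % 2 = 1) (h' : j + 5 ≤ 2*g) : 2 * pB g j = 4*g-5-j := by
  unfold pB
  rw [if_neg (by omega), if_pos h']; omega

theorem pB_v7 (g j : ℕ) (_hg : 9 ≤ g) (h : j % 2 = 1) (h' : 2*g ≤ j + 3) (h'' : j + 5 ≤ 4*g) : 2 * pB g j = -j-5 := by
  unfold pB
  rw [if_neg (by omega), if_neg (by omega), if_pos h'']; omega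

theorem pB_v8 (g j : ℕ) (_hg : 9 ≤ g) (h : j % 2 = 1) (h' : 4*g ≤ j + 3) (_h : j < 4*g+2) : 2 * pB g j = j - (4*g+1) := by
  unfold pB
  rw [if_neg (by omega), if_neg (by omega), if_neg (by omega)]; omega

theorem pB_spec (g j : ℕ) (hg : 9 ≤ g) (hj : j < 4*g+2) :
    (j % 2 = 0 ∧ j + 4 ≤ 2*g ∧ 2 * pB g j = j) ∨ (j % 2 = 0 ∧ 2*g ≤ j + 2 ∧ j + 6 ≤ 4*g ∧ 2 * pB g j = j - 4*g) ∨
    (j + 4 = 4*g ∧ pB g j = -(2*g+1)) ∨ (j + 2 = 4*g ∧ pB g j = 2*g+1) ∨ (j = 4*g ∧ pB g j = 2*g) ∨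
    (j % 2 = 1 ∧ j + 5 ≤ 2*g ∧ 2 * pB g j = 4*g-5-j) ∨
    (j % 2 = 1 ∧ 2*g ≤ j + 3 ∧ j + 5 ≤ 4*g ∧ 2 * pB g j = -j-5) ∨
    (j % 2 = 1 ∧ 4*g ≤ j + 3 ∧ 2 * pB g j = j - (4*g+1)) := by
  rcases Nat.mod_two_eq_zero_or_one j with h | h
  · by_cases a : j + 4 ≤ 2*g
    · exact Or.inl ⟨h, a, pB_v1 g j hg h a⟩
    refine Or.inr ?_
    by_cases b : j + 6 ≤ 4*g
    · exact Or.inl ⟨h, by omega, b, pB_v2 g j hg h (by omega) b⟩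
    refine Or.inr ?_
    by_cases c : j + 4 = 4*g
    · exact Or.inl ⟨c, pB_v3 g j hg c⟩
    refine Or.inr ?_
    by_cases d : j + 2 = 4*g
    · exact Or.inl ⟨d, pB_v4 g j hg d⟩
    have e : j = 4*g := by omega
    exact Or.inr (Or.inl ⟨e, pB_v5 g j hg e⟩)
  · refine Or.inr (Or.inr (Or.inr (Or.inr (Or.inr ?_))))
    by_cases a : j + 5 ≤ 2*g
    · exact Or.inl ⟨h, a, pB_v6 g j hg h a⟩
    refine Or.inr ?_
    by_cases b : j + 5 ≤ 4*g
    · exact Or.inl ⟨h, by omega, b, pB_v7 g j hg h (by omega) b⟩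
    exact Or.inr ⟨h, by omega, pB_v8 g j hg h (by omega) hj⟩

def EB (g : ℕ) (z : ℤ) : Prop := (0 ≤ z ∧ z ≤ g-2) ∨ (-g-1 ≤ z ∧ z ≤ -3) ∨ z = -2*g-1 ∨ z = 2*g+1 ∨ z = 2*g

def OB (g : ℕ) (z : ℤ) : Prop := (g ≤ z ∧ z ≤ 2*g-3) ∨ (-2*g ≤ z ∧ z ≤ -g-1) ∨ (-2 ≤ z ∧ z ≤ 0)

theorem pB_even (g j : ℕ) (hg : 9 ≤ g) (hj : j < 4*g+2) (h : j % 2 = 0) : EB g (pB g j) := by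
  have := pB_spec g j hg hj
  unfold EB
  omega

theorem pB_odd (g j : ℕ) (hg : 9 ≤ g) (hj : j < 4*g+2) (h : j % 2 = 1) : OB g (pB g j) := by
  have := pB_spec g j hg hj
  unfold OB
  omega

def RB (g : ℕ) (y : ℤ) : Prop := (0 ≤ y ∧ y ≤ g) ∨ (2*g+2 ≤ y ∧ y ≤ 3*g+1)

theorem B_pre (g : ℕ) (hg : 9 ≤ g) : XPre (4*g+3) (2*g+1) (((2*g-2 : ℤ)) : ZMod (4*g+3)) (cb (pB g)) := by
  apply XPre_base (by ring)
  · have := pB_spec g 0 hg (by omega); omega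
  · have := pB_spec g (2*(2*g+1)-1) hg (by omega); omega
  · intro j hj
    have := pB_spec g j hg (by omega); push_cast; omega
  · intro j j' hj hj' hp hE
    have h1 := pB_spec g j hg (by omega)
    have h2 := pB_spec g j' hg (by omega)
    push_cast at hE
    rcases h1 with h1 | h1 | h1 | h1 | h1 | h1 | h1 | h1 <;> rcases h2 with h2 | h2 | h2 | h2 | h2 | h2 | h2 | h2 <;>
      first | (exfalso; clear hE; omega) | omega
  · intro d h1 h2 h3 h4
    push_cast at h1 h2
    have hd : (2 ≤ d ∧ d ≤ 2*g-3) ∨ (-(2*g-3) ≤ d ∧ d ≤ 0) ∨ d = 1 ∨ d = -(2*g-1) ∨ d = 2*g-1 ∨ d = 2*g ∨ d = 2*g+1 ∨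
      d = -(2*g+1) ∨ d = -2*g := by omega
    rcases hd with hd | hd | hd | hd | hd | hd | hd | hd | hd
    · obtain ⟨J, hJ⟩ := Int.eq_ofNat_of_zero_le (show 0 ≤ 2*g-3-d by omega)
      refine ⟨J, by omega, 0, ?_⟩
      rcases Nat.mod_two_eq_zero_or_one J with hm | hm
      · have a1 := pB_v1 g J hg hm (by omega)
        have a2 := pB_v6 g (J+1) hg (by omega) (by omega)
        push_cast at a2
        omega
      · have a1 := pB_v6 g J hg hm (by omega)
        have a2 := pB_v1 g (J+1) hg (by omega) (by omega)
        push_cast at a2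
        omega
    · obtain ⟨J, hJ⟩ := Int.eq_ofNat_of_zero_le (show 0 ≤ 2*g-3-d by omega)
      refine ⟨J, by omega, 0, ?_⟩
      rcases Nat.mod_two_eq_zero_or_one J with hm | hm
      · have a1 := pB_v2 g J hg hm (by omega) (by omega)
        have a2 := pB_v7 g (J+1) hg (by omega) (by omega) (by omega)
        push_cast at a2
        omega
      · have a1 := pB_v7 g J hg hm (by omega) (by omega)
        have a2 := pB_v2 g (J+1) hg (by omega) (by omega) (by omega)
        push_cast at a2
        omega
    · refine ⟨4*g-5, by omega, 0, Or.inr ⟨by omega, ?_⟩⟩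
      have a1 := pB_v7 g (4*g-5) hg (by omega) (by omega) (by omega)
      have a2 := pB_v3 g (4*g-5+1) hg (by omega)
      omega
    · refine ⟨2*g-4, by omega, 0, Or.inl ⟨by omega, ?_⟩⟩
      have a1 := pB_v1 g (2*g-4) hg (by omega) (by omega)
      have a2 := pB_v7 g (2*g-4+1) hg (by omega) (by omega) (by omega)
      omega
    · refine ⟨4*g-4, by omega, 0, Or.inl ⟨by omega, ?_⟩⟩
      have a1 := pB_v3 g (4*g-4) hg (by omega)
      have a2 := pB_v8 g (4*g-4+1) hg (by omega) (by omega) (by omega)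
      omega
    · refine ⟨4*g-3, by omega, -1, Or.inr ⟨by omega, ?_⟩⟩
      have a1 := pB_v8 g (4*g-3) hg (by omega) (by omega) (by omega)
      have a2 := pB_v4 g (4*g-3+1) hg (by omega)
      push_cast; omega
    · refine ⟨4*g-2, by omega, -1, Or.inl ⟨by omega, ?_⟩⟩
      have a1 := pB_v4 g (4*g-2) hg (by omega)
      have a2 := pB_v8 g (4*g-2+1) hg (by omega) (by omega) (by omega)
      push_cast; omega
    · refine ⟨4*g-1, by omega, 0, Or.inr ⟨by omega, ?_⟩⟩
      have a1 := pB_v8 g (4*g-1) hg (by omega) (by omega) (by omega)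
      have a2 := pB_v5 g (4*g-1+1) hg (by omega)
      omega
    · refine ⟨4*g, by omega, 0, Or.inl ⟨by omega, ?_⟩⟩
      have a1 := pB_v5 g (4*g) hg (by omega)
      have a2 := pB_v8 g (4*g+1) hg (by omega) (by omega) (by omega)
      omega

theorem B_total (g : ℕ) : SS (fun x => rd (colR (4*g+3) (RB g)) ((x : ℤ) : ZMod (4*g+3))) 0 (4*g+3) = 2*g+1 := by
  set f : ℤ → ℕ := fun x => rd (colR (4*g+3) (RB g)) ((x : ℤ) : ZMod (4*g+3)) with hf
  have sp : ∀ x : ℤ, 0 ≤ x → x < 4*g+3 → (RB g x ∧ f x = 1) ∨ (¬ RB g x ∧ f x = 0) := by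
    intro x h1 h2
    obtain ⟨y, a, b, c, d⟩ := colR_spec (ℓ := 4*g+3) (RB g) x (by omega) (by omega)
    have : y = x := by push_cast at *; omega
    rwa [this] at d
  have s2 : SS f 0 (g+1) = (g+1) * 1 := SS_const _ _ _ _ (fun x h1 h2 => by
    have := sp x (by omega) (by omega); unfold RB at this; omega)
  have s3 : SS f (g+1) (g+1) = (g+1) * 0 := SS_const _ _ _ _ (fun x h1 h2 => by
    have := sp x (by omega) (by omega); unfold RB at this; omega)
  have s4 : SS f (2*g+2) g = g * 1 := SS_const _ _ _ _ (fun x h1 h2 => by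
    have := sp x (by omega) (by omega); unfold RB at this; omega)
  have s5 : SS f (3*g+2) (g+1) = (g+1) * 0 := SS_const _ _ _ _ (fun x h1 h2 => by
    have := sp x (by omega) (by omega); unfold RB at this; omega)
  have g2 : SS f 0 (g+1) + SS f (g+1) (g+1) = SS f 0 (2*g+2) := SS_glue f (by omega) (by omega)
  have g3 : SS f 0 (2*g+2) + SS f (2*g+2) g = SS f 0 (3*g+2) := SS_glue f (by omega) (by omega)
  have g4 : SS f 0 (3*g+2) + SS f (3*g+2) (g+1) = SS f 0 (4*g+3) := SS_glue f (by omega) (by omega)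
  omega

theorem B_cnt (g : ℕ) (hg : 9 ≤ g) (n : ℤ) (f : ℤ → ℕ)
    (hf : f = fun x => rd (colR (4*g+3) (RB g)) ((x : ℤ) : ZMod (4*g+3))) :
    xcnt (2*g+1) (((2*g-2 : ℤ)) : ZMod (4*g+3)) (cb (pB g)) (colR (4*g+3) (RB g)) ((n : ℤ) : ZMod (4*g+3))
      + f (n + g - 1) + f (n + 2*g - 1) = 2*g+1 + f n + f (n-g-1) := by
  have hper : ∀ x, f (x + (4*g+3 : ℕ)) = f x := by intro x; rw [hf]; exact rd_period _ x
  have htot : SS f (n - 2*g - 1) (4*g+3) = 2*g+1 := by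
    rw [SS_period f _ hper, hf]; exact B_total g
  unfold xcnt
  have hA : rd (colR (4*g+3) (RB g)) (((n : ℤ) : ZMod (4*g+3)) + (((2*g-2 : ℤ)) : ZMod (4*g+3))) = f (n+2*g-2) := by
    rw [hf]; beta_reduce; congr 1; push_cast; ring
  have hG : ∀ j, rd (colR (4*g+3) (RB g)) (cb (pB g) ((n : ℤ) : ZMod (4*g+3)) j) = f (n + pB g j) := by
    intro j; rw [cb_int, hf]
  rw [hA]
  simp only [hG]
  rw [sum_pairs (fun j => f (n + pB g j))]
  rw [sum_up f (fun t => f (n + pB g (2*t))) (n := 2*g) (m := 1) (n+2*g) (by omega) (by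
    intro j hj
    have := pB_v5 g (2*(2*g+j)) hg (by omega)
    congr 1; push_cast at *; omega)]
  rw [sum_up f (fun t => f (n + pB g (2*t))) (n := 2*g-1) (m := 1) (n+2*g+1) (by omega) (by
    intro j hj
    have := pB_v4 g (2*(2*g-1+j)) hg (by omega)
    congr 1; push_cast at *; omega)]
  rw [sum_up f (fun t => f (n + pB g (2*t))) (n := 2*g-2) (m := 1) (n-2*g-1) (by omega) (by
    intro j hj
    have := pB_v3 g (2*(2*g-2+j)) hg (by omega)
    congr 1; push_cast at *; omega)]
  rw [sum_up f (fun t => f (n + pB g (2*t))) (n := g-1) (m := g-1) (n-g-1) (by omega) (by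
    intro j hj
    have := pB_v2 g (2*(g-1+j)) hg (by omega) (by omega) (by omega)
    congr 1; push_cast at *; omega)]
  rw [sum_up f (fun t => f (n + pB g (2*t))) (n := 0) (m := g-1) n (by omega) (by
    intro j hj
    have := pB_v1 g (2*(0+j)) hg (by omega) (by omega)
    congr 1; push_cast at *; omega)]
  rw [sum_up f (fun t => f (n + pB g (2*t+1))) (n := 2*g-2) (m := 3) (n-2) (by omega) (by
    intro j hj
    have := pB_v8 g (2*(2*g-2+j)+1) hg (by omega) (by omega) (by omega)
    congr 1; push_cast at *; omega)]
  rw [sum_down f (fun t => f (n + pB g (2*t+1))) (n := g-2) (m := g) (n-2*g) (by omega) (by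
    intro j hj
    have := pB_v7 g (2*(g-2+j)+1) hg (by omega) (by omega) (by omega)
    congr 1; push_cast at *; omega)]
  rw [sum_down f (fun t => f (n + pB g (2*t+1))) (n := 0) (m := g-2) (n+g) (by omega) (by
    intro j hj
    have := pB_v6 g (2*(0+j)+1) hg (by omega) (by omega)
    congr 1; push_cast at *; omega)]
  simp only [Finset.range_zero, Finset.sum_empty]
  have a1 : SS f (n-g-1) 1 + SS f (n-g) (g-2) = SS f (n-g-1) (g-1) := SS_glue f (by omega) (by omega)
  have a2 : SS f n 1 + SS f (n+1) (g-2) = SS f n (g-1) := SS_glue f (by omega) (by omega)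
  have g1 : SS f (n-2*g-1) 1 + SS f (n-2*g) g = SS f (n-2*g-1) (g+1) := SS_glue f (by omega) (by omega)
  have g2 : SS f (n-2*g-1) (g+1) + SS f (n-g) (g-2) = SS f (n-2*g-1) (2*g-1) := SS_glue f (by omega) (by omega)
  have g3 : SS f (n-2*g-1) (2*g-1) + SS f (n-2) 3 = SS f (n-2*g-1) (2*g+2) := SS_glue f (by omega) (by omega)
  have g4 : SS f (n-2*g-1) (2*g+2) + SS f (n+1) (g-2) = SS f (n-2*g-1) (3*g) := SS_glue f (by omega) (by omega)
  have g5 : SS f (n-2*g-1) (3*g) + SS f (n+g-1) 1 = SS f (n-2*g-1) (3*g+1) := SS_glue f (by omega) (by omega)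
  have g6 : SS f (n-2*g-1) (3*g+1) + SS f (n+g) (g-2) = SS f (n-2*g-1) (4*g-1) := SS_glue f (by omega) (by omega)
  have g7 : SS f (n-2*g-1) (4*g-1) + SS f (n+2*g-2) 1 = SS f (n-2*g-1) (4*g) := SS_glue f (by omega) (by omega)
  have g8 : SS f (n-2*g-1) (4*g) + SS f (n+2*g-1) 1 = SS f (n-2*g-1) (4*g+1) := SS_glue f (by omega) (by omega)
  have g9 : SS f (n-2*g-1) (4*g+1) + SS f (n+2*g) 1 = SS f (n-2*g-1) (4*g+2) := SS_glue f (by omega) (by omega)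
  have g10 : SS f (n-2*g-1) (4*g+2) + SS f (n+2*g+1) 1 = SS f (n-2*g-1) (4*g+3) := SS_glue f (by omega) (by omega)
  simp only [SS_one] at *
  linarith

theorem B_base (g : ℕ) (hg : 9 ≤ g) (i : ZMod (4*g+3)) (n : ℤ) (hi : i = ((n : ℤ) : ZMod (4*g+3))) (hn1 : 0 ≤ n) (hn2 : n < 4*g+3) : ∃ N, xcnt (2*g+1) (((2*g-2 : ℤ)) : ZMod (4*g+3)) (cb (pB g)) (colR (4*g+3) (RB g)) i = N ∧
      ((n = 2 ∨ n = 2*g+3) ∧ N = 2*g+2 ∨ (n = 3*g+2 ∨ n = 3*g+4) ∧ N + 1 = 2*g+1 ∨ n ≠ 2 ∧ n ≠ 2*g+3 ∧ n ≠ 3*g+2 ∧ n ≠ 3*g+4 ∧ (N = 2*g+1)) := by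
  subst hi
  refine ⟨_, rfl, ?_⟩
  have sp := colR_spec (ℓ := 4*g+3) (RB g)
  have hc := B_cnt g hg n _ rfl
  obtain ⟨y1, a1, b1, c1, d1⟩ := sp (n + g - 1) (by push_cast; omega) (by push_cast; omega)
  obtain ⟨y2, a2, b2, c2, d2⟩ := sp (n + 2*g - 1) (by push_cast; omega) (by push_cast; omega)
  obtain ⟨y3, a3, b3, c3, d3⟩ := sp n (by push_cast; omega) (by push_cast; omega)
  obtain ⟨y4, a4, b4, c4, d4⟩ := sp (n - g - 1) (by push_cast; omega) (by push_cast; omega)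
  beta_reduce at hc
  generalize xcnt (2*g+1) (((2*g-2 : ℤ)) : ZMod (4*g+3)) (cb (pB g)) (colR (4*g+3) (RB g)) ((n : ℤ) : ZMod (4*g+3)) = N at *
  generalize rd (colR (4*g+3) (RB g)) (((n + g - 1 : ℤ)) : ZMod (4*g+3)) = r1 at *
  generalize rd (colR (4*g+3) (RB g)) (((n + 2*g - 1 : ℤ)) : ZMod (4*g+3)) = r2 at *
  generalize rd (colR (4*g+3) (RB g)) (((n : ℤ)) : ZMod (4*g+3)) = r3 at *
  generalize rd (colR (4*g+3) (RB g)) (((n - g - 1 : ℤ)) : ZMod (4*g+3)) = r4 at *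
  clear sp
  unfold RB at d1 d2 d3 d4
  push_cast at b1 b2 b3 b4 c1 c2 c3 c4
  have q3 : y3 = n := by omega
  subst q3
  clear c3
  have q1 : (y1 = y3 + g - 1 ∧ y3 ≤ 3*g+3) ∨ (y1 = y3 - 3*g - 4 ∧ 3*g+4 ≤ y3) := by omega
  have q2 : (y2 = y3 + 2*g - 1 ∧ y3 ≤ 2*g+3) ∨ (y2 = y3 - 2*g - 4 ∧ 2*g+4 ≤ y3) := by omega
  have q4 : (y4 = y3 - g - 1 ∧ g+1 ≤ y3) ∨ (y4 = y3 + 3*g + 2 ∧ y3 < g+1) := by omega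
  clear c1 c2 c4
  rcases q1 with ⟨rfl, u1⟩ | ⟨rfl, u1⟩ <;> rcases q2 with ⟨rfl, u2⟩ | ⟨rfl, u2⟩ <;>
    rcases q4 with ⟨rfl, u4⟩ | ⟨rfl, u4⟩ <;> first | (exfalso; clear d1 d2 d3 d4; omega) |
    (rcases d1 with ⟨d1, rfl⟩ | ⟨d1, rfl⟩ <;> rcases d2 with ⟨d2, rfl⟩ | ⟨d2, rfl⟩ <;> first | (exfalso; clear d3 d4; omega) |
     (rcases d3 with ⟨d3, rfl⟩ | ⟨d3, rfl⟩ <;> first | (exfalso; clear d4; omega) | (rcases d4 with ⟨d4, rfl⟩ | ⟨d4, rfl⟩ <;> omega)))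

theorem pB_ev (g j : ℕ) (hg : 9 ≤ g) (hj : j < 4*g+2) (p : ℕ) (hp : p % 2 = 0) (h : j % 2 = p % 2) : EB g (pB g j) :=
  pB_even g j hg hj (h.trans hp)

theorem pB_od (g j : ℕ) (hg : 9 ≤ g) (hj : j < 4*g+2) (p : ℕ) (hp : p % 2 = 1) (h : j % 2 = p % 2) : OB g (pB g j) :=
  pB_odd g j hg hj (h.trans hp)

theorem B_P1 (g p : ℕ) (hg : 9 ≤ g) (hp : p + 5 = 2*g) : pB g (p) = g := by
  have := pB_v6 g (p) hg (by omega) (by omega)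
  omega

theorem B_P1m (g p : ℕ) (hg : 9 ≤ g) (hp : p + 5 = 2*g) : pB g (p-1) = g-3 := by
  have := pB_v1 g (p-1) hg (by omega) (by omega)
  omega

theorem B_P1p (g p : ℕ) (hg : 9 ≤ g) (hp : p + 5 = 2*g) : pB g (p+1) = g-2 := by
  have := pB_v1 g (p+1) hg (by omega) (by omega)
  omega

theorem B_Q1 (g p : ℕ) (hg : 9 ≤ g) (hp : p + 11 = 4*g) : pB g (p) = -2*g+3 := by
  have := pB_v7 g (p) hg (by omega) (by omega) (by omega)
  omega

theorem B_Q1m (g p : ℕ) (hg : 9 ≤ g) (hp : p + 11 = 4*g) : pB g (p-1) = -6 := by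
  have := pB_v2 g (p-1) hg (by omega) (by omega) (by omega)
  omega

theorem B_Q1p (g p : ℕ) (hg : 9 ≤ g) (hp : p + 11 = 4*g) : pB g (p+1) = -5 := by
  have := pB_v2 g (p+1) hg (by omega) (by omega) (by omega)
  omega

theorem B_P2 (g p : ℕ) (hg : 9 ≤ g) (hp : p + 6 = 2*g) : pB g (p) = g-3 := by
  have := pB_v1 g (p) hg (by omega) (by omega)
  omega

theorem B_P2m (g p : ℕ) (hg : 9 ≤ g) (hp : p + 6 = 2*g) : pB g (p-1) = g+1 := by
  have := pB_v6 g (p-1) hg (by omega) (by omega)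
  omega

theorem B_P2p (g p : ℕ) (hg : 9 ≤ g) (hp : p + 6 = 2*g) : pB g (p+1) = g := by
  have := pB_v6 g (p+1) hg (by omega) (by omega)
  omega

theorem B_Q2 (g p : ℕ) (hg : 9 ≤ g) (hp : p = 2*g) : pB g (p) = -g := by
  have := pB_v2 g (p) hg (by omega) (by omega) (by omega)
  omega

theorem B_Q2m (g p : ℕ) (hg : 9 ≤ g) (hp : p = 2*g) : pB g (p-1) = -g-2 := by
  have := pB_v7 g (p-1) hg (by omega) (by omega) (by omega)
  omega

theorem B_Q2p (g p : ℕ) (hg : 9 ≤ g) (hp : p = 2*g) : pB g (p+1) = -g-3 := by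
  have := pB_v7 g (p+1) hg (by omega) (by omega) (by omega)
  omega

theorem B_P3 (g p : ℕ) (hg : 9 ≤ g) (hp : p + 6 = 4*g) : pB g (p) = -3 := by
  have := pB_v2 g (p) hg (by omega) (by omega) (by omega)
  omega

theorem B_P3m (g p : ℕ) (hg : 9 ≤ g) (hp : p + 6 = 4*g) : pB g (p-1) = -2*g+1 := by
  have := pB_v7 g (p-1) hg (by omega) (by omega) (by omega)
  omega

theorem B_P3p (g p : ℕ) (hg : 9 ≤ g) (hp : p + 6 = 4*g) : pB g (p+1) = -2*g := by
  have := pB_v7 g (p+1) hg (by omega) (by omega) (by omega)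
  omega

theorem B_Q3 (g p : ℕ) (hg : 9 ≤ g) (hp : p + 14 = 2*g) : pB g (p) = g-7 := by
  have := pB_v1 g (p) hg (by omega) (by omega)
  omega

theorem B_Q3m (g p : ℕ) (hg : 9 ≤ g) (hp : p + 14 = 2*g) : pB g (p-1) = g+5 := by
  have := pB_v6 g (p-1) hg (by omega) (by omega)
  omega

theorem B_Q3p (g p : ℕ) (hg : 9 ≤ g) (hp : p + 14 = 2*g) : pB g (p+1) = g+4 := by
  have := pB_v6 g (p+1) hg (by omega) (by omega)
  omega

set_option maxHeartbeats 2000000 in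
theorem B_ok (g : ℕ) (hg : 9 ≤ g) : XOk (4*g+3) (2*g+1) := by
  have H0 := B_pre g hg
  have N1 : ∀ z : ℤ, OB g z → ((3*g+2+z : ℤ) : ZMod (4*g+3)) ≠ ((2+(-2*g+3) : ℤ) : ZMod (4*g+3)) := by
    intro z a; unfold OB at a; apply zc_ne <;> push_cast <;> omega
  have N2 : ∀ z : ℤ, OB g z → ((2+z : ℤ) : ZMod (4*g+3)) ≠ ((3*g+2+g : ℤ) : ZMod (4*g+3)) := by
    intro z a; unfold OB at a; apply zc_ne <;> push_cast <;> omega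
  have N3 : ∀ z : ℤ, EB g z → ((3*g+4+z : ℤ) : ZMod (4*g+3)) ≠ ((g+4+(-g) : ℤ) : ZMod (4*g+3)) := by
    intro z a; unfold EB at a; apply zc_ne <;> push_cast <;> omega
  have N4 : ∀ z : ℤ, EB g z → ((g+4+z : ℤ) : ZMod (4*g+3)) ≠ ((3*g+4+(g-3) : ℤ) : ZMod (4*g+3)) := by
    intro z a; unfold EB at a; apply zc_ne <;> push_cast <;> omega
  have N5 : ∀ z : ℤ, EB g z → ((g+4+z : ℤ) : ZMod (4*g+3)) ≠ ((2*g+3+(g-7) : ℤ) : ZMod (4*g+3)) := by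
    intro z a; unfold EB at a; apply zc_ne <;> push_cast <;> omega
  have N6 : ∀ z : ℤ, EB g z → ((2*g+3+z : ℤ) : ZMod (4*g+3)) ≠ ((g+4+(-3) : ℤ) : ZMod (4*g+3)) := by
    intro z a; unfold EB at a; apply zc_ne <;> push_cast <;> omega
  have N7 : ((3*g+4+(g-3) : ℤ) : ZMod (4*g+3)) ≠ ((2*g+3+(g-7) : ℤ) : ZMod (4*g+3)) := by
    apply zc_ne <;> push_cast <;> omega
  obtain ⟨p1, hp1⟩ : ∃ p1, p1 + 5 = 2*g := ⟨2*g-5, by omega⟩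
  obtain ⟨q1, hq1⟩ : ∃ q1, q1 + 11 = 4*g := ⟨4*g-11, by omega⟩
  obtain ⟨p2, hp2⟩ : ∃ p2, p2 + 6 = 2*g := ⟨2*g-6, by omega⟩
  obtain ⟨q2, hq2⟩ : ∃ q2, q2 = 2*g := ⟨2*g, by omega⟩
  obtain ⟨p3, hp3⟩ : ∃ p3, p3 + 6 = 4*g := ⟨4*g-6, by omega⟩
  obtain ⟨q3, hq3⟩ : ∃ q3, q3 + 14 = 2*g := ⟨2*g-14, by omega⟩
  obtain ⟨I, hI⟩ : ∃ I : ZMod (4*g+3), I = ((3*g+2 : ℤ) : ZMod (4*g+3)) := ⟨_, rfl⟩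
  obtain ⟨J, hJ⟩ : ∃ J : ZMod (4*g+3), J = ((2 : ℤ) : ZMod (4*g+3)) := ⟨_, rfl⟩
  obtain ⟨L, hL⟩ : ∃ L : ZMod (4*g+3), L = ((3*g+4 : ℤ) : ZMod (4*g+3)) := ⟨_, rfl⟩
  obtain ⟨M, hM⟩ : ∃ M : ZMod (4*g+3), M = ((g+4 : ℤ) : ZMod (4*g+3)) := ⟨_, rfl⟩
  obtain ⟨Q, hQ⟩ : ∃ Q : ZMod (4*g+3), Q = ((2*g+3 : ℤ) : ZMod (4*g+3)) := ⟨_, rfl⟩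
  have nIJ : I ≠ J := by
    rw [hI, hJ]; apply zc_ne <;> push_cast <;> omega
  have nIL : I ≠ L := by
    rw [hI, hL]; apply zc_ne <;> push_cast <;> omega
  have nIM : I ≠ M := by
    rw [hI, hM]; apply zc_ne <;> push_cast <;> omega
  have nIQ : I ≠ Q := by
    rw [hI, hQ]; apply zc_ne <;> push_cast <;> omega
  have nJL : J ≠ L := by
    rw [hJ, hL]; apply zc_ne <;> push_cast <;> omega
  have nJM : J ≠ M := by
    rw [hJ, hM]; apply zc_ne <;> push_cast <;> omega
  have nJQ : J ≠ Q := by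
    rw [hJ, hQ]; apply zc_ne <;> push_cast <;> omega
  have nLM : L ≠ M := by
    rw [hL, hM]; apply zc_ne <;> push_cast <;> omega
  have nLQ : L ≠ Q := by
    rw [hL, hQ]; apply zc_ne <;> push_cast <;> omega
  have nMQ : M ≠ Q := by
    rw [hM, hQ]; apply zc_ne <;> push_cast <;> omega
  have H1 := H0.trade I p1 J q1 nIJ (by omega) (by omega) (by omega) (by omega) (by omega)
    (by
      left; rw [hI, hJ, cb_int, cb_int, cb_int, cb_int, B_P1m g p1 hg hp1, B_P1p g p1 hg hp1, B_Q1m g q1 hg hq1, B_Q1p g q1 hg hq1]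
      constructor
      · exact zc_intro (1) (by push_cast; ring)
      · exact zc_intro (1) (by push_cast; ring))
    (by
      intro j hj hjp hE
      rw [hI, hJ, cb_int, cb_int, B_Q1 g q1 hg hq1] at hE
      exact N1 _ (pB_od g j hg (by omega) p1 (by omega) (by omega)) hE)
    (by
      intro j hj hjp hE
      rw [hI, hJ, cb_int, cb_int, B_P1 g p1 hg hp1] at hE
      exact N2 _ (pB_od g j hg (by omega) p1 (by omega) (by omega)) hE)
  have tL : ∀ j, tr (cb (pB g)) I p1 J q1 L j = cb (pB g) L j := fun j => tr_cyc nIL.symm nJL.symm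
  have tM : ∀ j, tr (cb (pB g)) I p1 J q1 M j = cb (pB g) M j := fun j => tr_cyc nIM.symm nJM.symm
  have tQ : ∀ j, tr (cb (pB g)) I p1 J q1 Q j = cb (pB g) Q j := fun j => tr_cyc nIQ.symm nJQ.symm
  have H2 := H1.trade L p2 M q2 nLM (by omega) (by omega) (by omega) (by omega) (by omega)
    (by
      rw [tL, tL, tM, tM]
      left; rw [hL, hM, cb_int, cb_int, cb_int, cb_int, B_P2m g p2 hg hp2, B_P2p g p2 hg hp2, B_Q2m g q2 hg hq2, B_Q2p g q2 hg hq2]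
      constructor
      · exact zc_intro (1) (by push_cast; ring)
      · exact zc_intro (1) (by push_cast; ring))
    (by
      intro j hj hjp hE
      rw [tL, tM] at hE
      rw [hL, hM, cb_int, cb_int, B_Q2 g q2 hg hq2] at hE
      exact N3 _ (pB_ev g j hg (by omega) p2 (by omega) (by omega)) hE)
    (by
      intro j hj hjp hE
      rw [tL, tM] at hE
      rw [hL, hM, cb_int, cb_int, B_P2 g p2 hg hp2] at hE
      exact N4 _ (pB_ev g j hg (by omega) p2 (by omega) (by omega)) hE)
  have uM : ∀ j, j ≠ q2 → tr (tr (cb (pB g)) I p1 J q1) L p2 M q2 M j = cb (pB g) M j :=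
    fun j hj => (tr_r' nLM hj).trans (tM j)
  have uM2 : tr (tr (cb (pB g)) I p1 J q1) L p2 M q2 M q2 = cb (pB g) L p2 := (tr_r nLM).trans (tL p2)
  have uQ : ∀ j, tr (tr (cb (pB g)) I p1 J q1) L p2 M q2 Q j = cb (pB g) Q j :=
    fun j => (tr_cyc nLQ.symm nMQ.symm).trans (tQ j)
  have H3 := H2.trade M p3 Q q3 nMQ (by omega) (by omega) (by omega) (by omega) (by omega)
    (by
      rw [uM _ (by omega), uM _ (by omega), uQ, uQ]
      left; rw [hM, hQ, cb_int, cb_int, cb_int, cb_int, B_P3m g p3 hg hp3, B_P3p g p3 hg hp3, B_Q3m g q3 hg hq3, B_Q3p g q3 hg hq3]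
      constructor
      · exact zc_intro (-1) (by push_cast; ring)
      · exact zc_intro (-1) (by push_cast; ring))
    (by
      intro j hj hjp hE
      rw [uQ] at hE
      by_cases hq : j = q2
      · rw [hq, uM2, hL, hQ, cb_int, cb_int, B_P2 g p2 hg hp2, B_Q3 g q3 hg hq3] at hE
        exact N7 hE
      rw [uM _ hq] at hE
      rw [hM, hQ, cb_int, cb_int, B_Q3 g q3 hg hq3] at hE
      exact N5 _ (pB_ev g j hg (by omega) p3 (by omega) (by omega)) hE)
    (by
      intro j hj hjp hE
      rw [uM _ (by omega), uQ] at hE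
      rw [hM, hQ, cb_int, cb_int, B_P3 g p3 hg hp3] at hE
      exact N6 _ (pB_ev g j hg (by omega) p3 (by omega) (by omega)) hE)
  refine ⟨colR (4*g+3) (RB g), _, _, H3, (SS_total _).trans (B_total g), ?_⟩
  have sp := colR_spec (ℓ := 4*g+3) (RB g)
  have e1 : rd (colR (4*g+3) (RB g)) (cb (pB g) I p1) = 0 := by
    rw [hI, cb_int, B_P1 g p1 hg hp1]
    obtain ⟨y, a1, a2, a3, a4⟩ := sp (3*g+2 + g) (by push_cast; omega) (by push_cast; omega)
    rcases a4 with ⟨a4, a5⟩ | ⟨a4, a5⟩ <;> first | exact a5 | (exfalso; unfold RB at a4; push_cast at a2 a3; clear a5; omega)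
  have e2 : rd (colR (4*g+3) (RB g)) (cb (pB g) J q1) = 1 := by
    rw [hJ, cb_int, B_Q1 g q1 hg hq1]
    obtain ⟨y, a1, a2, a3, a4⟩ := sp (2 + (-2*g+3)) (by push_cast; omega) (by push_cast; omega)
    rcases a4 with ⟨a4, a5⟩ | ⟨a4, a5⟩ <;> first | exact a5 | (exfalso; unfold RB at a4; push_cast at a2 a3; clear a5; omega)
  have e3 : rd (colR (4*g+3) (RB g)) (cb (pB g) L p2) = 0 := by
    rw [hL, cb_int, B_P2 g p2 hg hp2]
    obtain ⟨y, a1, a2, a3, a4⟩ := sp (3*g+4 + (g-3)) (by push_cast; omega) (by push_cast; omega)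
    rcases a4 with ⟨a4, a5⟩ | ⟨a4, a5⟩ <;> first | exact a5 | (exfalso; unfold RB at a4; push_cast at a2 a3; clear a5; omega)
  have e4 : rd (colR (4*g+3) (RB g)) (cb (pB g) M q2) = 1 := by
    rw [hM, cb_int, B_Q2 g q2 hg hq2]
    obtain ⟨y, a1, a2, a3, a4⟩ := sp (g+4 + -g) (by push_cast; omega) (by push_cast; omega)
    rcases a4 with ⟨a4, a5⟩ | ⟨a4, a5⟩ <;> first | exact a5 | (exfalso; unfold RB at a4; push_cast at a2 a3; clear a5; omega)
  have e5 : rd (colR (4*g+3) (RB g)) (cb (pB g) M p3) = 0 := by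
    rw [hM, cb_int, B_P3 g p3 hg hp3]
    obtain ⟨y, a1, a2, a3, a4⟩ := sp (g+4 + -3) (by push_cast; omega) (by push_cast; omega)
    rcases a4 with ⟨a4, a5⟩ | ⟨a4, a5⟩ <;> first | exact a5 | (exfalso; unfold RB at a4; push_cast at a2 a3; clear a5; omega)
  have e6 : rd (colR (4*g+3) (RB g)) (cb (pB g) Q q3) = 1 := by
    rw [hQ, cb_int, B_Q3 g q3 hg hq3]
    obtain ⟨y, a1, a2, a3, a4⟩ := sp (2*g+3 + (g-7)) (by push_cast; omega) (by push_cast; omega)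
    rcases a4 with ⟨a4, a5⟩ | ⟨a4, a5⟩ <;> first | exact a5 | (exfalso; unfold RB at a4; push_cast at a2 a3; clear a5; omega)
  have t1 := tL p2
  have t2 := tM q2
  have t3 := uM p3 (by omega)
  have t4 := uQ q3
  clear N1 N2 N3 N4 N5 N6 N7 tL tM tQ uM uM2 uQ sp
  intro i
  have BI : xcnt (2*g+1) (((2*g-2 : ℤ)) : ZMod (4*g+3)) (cb (pB g)) (colR (4*g+3) (RB g)) I + 1 = 2*g+1 := by
    obtain ⟨N, h, h'⟩ := B_base g hg I (3*g+2) hI (by omega) (by omega)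
    rw [h]; omega
  have BJ : xcnt (2*g+1) (((2*g-2 : ℤ)) : ZMod (4*g+3)) (cb (pB g)) (colR (4*g+3) (RB g)) J = 2*g+2 := by
    obtain ⟨N, h, h'⟩ := B_base g hg J (2) hJ (by omega) (by omega)
    rw [h]; omega
  have BL : xcnt (2*g+1) (((2*g-2 : ℤ)) : ZMod (4*g+3)) (cb (pB g)) (colR (4*g+3) (RB g)) L + 1 = 2*g+1 := by
    obtain ⟨N, h, h'⟩ := B_base g hg L (3*g+4) hL (by omega) (by omega)
    rw [h]; omega
  have BM : xcnt (2*g+1) (((2*g-2 : ℤ)) : ZMod (4*g+3)) (cb (pB g)) (colR (4*g+3) (RB g)) M = 2*g+1 := by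
    obtain ⟨N, h, h'⟩ := B_base g hg M (g+4) hM (by omega) (by omega)
    rw [h]; omega
  have BQ : xcnt (2*g+1) (((2*g-2 : ℤ)) : ZMod (4*g+3)) (cb (pB g)) (colR (4*g+3) (RB g)) Q = 2*g+2 := by
    obtain ⟨N, h, h'⟩ := B_base g hg Q (2*g+3) hQ (by omega) (by omega)
    rw [h]; omega
  by_cases iI : i = I
  · rw [iI, xcnt_o _ nIM nIQ, xcnt_o _ nIL nIM]
    have a := xcnt_l (h := 2*g+1) (e := (((2*g-2 : ℤ)) : ZMod (4*g+3))) (c := cb (pB g)) (colR (4*g+3) (RB g)) (p := p1) (q := q1) nIJ (by omega)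
    clear t1 t2 t3 t4
    omega
  by_cases iJ : i = J
  · rw [iJ, xcnt_o _ nJM nJQ, xcnt_o _ nJL nJM]
    have a := xcnt_r (h := 2*g+1) (e := (((2*g-2 : ℤ)) : ZMod (4*g+3))) (c := cb (pB g)) (colR (4*g+3) (RB g)) (p := p1) (q := q1) nIJ (by omega)
    clear t1 t2 t3 t4
    omega
  by_cases iL : i = L
  · rw [iL, xcnt_o _ nLM nLQ]
    have a := xcnt_l (h := 2*g+1) (e := (((2*g-2 : ℤ)) : ZMod (4*g+3))) (c := tr (cb (pB g)) I p1 J q1) (colR (4*g+3) (RB g)) (p := p2) (q := q2) nLM (by omega)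
    rw [xcnt_o (c := cb (pB g)) _ nIL.symm nJL.symm, t1, t2] at a
    clear t1 t2 t3 t4
    omega
  by_cases iM : i = M
  · rw [iM]
    have b := xcnt_r (h := 2*g+1) (e := (((2*g-2 : ℤ)) : ZMod (4*g+3))) (c := tr (cb (pB g)) I p1 J q1) (colR (4*g+3) (RB g)) (p := p2) (q := q2) nLM (by omega)
    rw [xcnt_o (c := cb (pB g)) _ nIM.symm nJM.symm, t1, t2] at b
    have a := xcnt_l (h := 2*g+1) (e := (((2*g-2 : ℤ)) : ZMod (4*g+3))) (c := tr (tr (cb (pB g)) I p1 J q1) L p2 M q2) (colR (4*g+3) (RB g)) (p := p3) (q := q3) nMQ (by omega)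
    rw [t3, t4] at a
    clear t1 t2 t3 t4
    omega
  by_cases iQ : i = Q
  · rw [iQ]
    have a := xcnt_r (h := 2*g+1) (e := (((2*g-2 : ℤ)) : ZMod (4*g+3))) (c := tr (tr (cb (pB g)) I p1 J q1) L p2 M q2) (colR (4*g+3) (RB g)) (p := p3) (q := q3) nMQ (by omega)
    rw [xcnt_o (c := tr (cb (pB g)) I p1 J q1) _ nLQ.symm nMQ.symm, xcnt_o (c := cb (pB g)) _ nIQ.symm nJQ.symm, t3, t4] at a
    clear t1 t2 t3 t4
    omega
  rw [xcnt_o _ iM iQ, xcnt_o _ iL iM, xcnt_o _ iI iJ]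
  obtain ⟨n, hn0, hn1, hn⟩ := zc_rep i
  have c1 : n ≠ 2 := by rintro rfl; exact iJ (hn.trans hJ.symm)
  have c2 : n ≠ 2*g+3 := by rintro rfl; exact iQ (hn.trans hQ.symm)
  have c3 : n ≠ 3*g+2 := by rintro rfl; exact iI (hn.trans hI.symm)
  have c4 : n ≠ 3*g+4 := by rintro rfl; exact iL (hn.trans hL.symm)
  obtain ⟨N, h, h'⟩ := B_base g hg i n hn hn0 (by push_cast at hn1; omega)
  refine Or.inl (h.trans ?_)
  clear hn1
  omega
theorem XOk_all (ℓ h : ℕ) [NeZero ℓ] (h7 : 7 ≤ ℓ) (hh : ℓ = 2*h+1) : XOk ℓ h := by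
  rcases Nat.mod_two_eq_zero_or_one h with hm | hm
  · obtain ⟨g, rfl⟩ : ∃ g, h = 2*g+2 := ⟨h/2-1, by omega⟩
    obtain rfl : ℓ = 4*g+5 := by omega
    have hc : g = 1 ∨ g = 2 ∨ g = 4 ∨ (g + 3 ≤ 3*((g+1)/2) ∧ 2*((g+1)/2) ≤ g+1 ∧ 2 ≤ (g+1)/2) := by omega
    rcases hc with rfl | rfl | rfl | ⟨a, b, c⟩
    · convert small_9
    · convert small_13
    · convert small_21
    · convert A_ok g _ a b c
  · obtain ⟨g, rfl⟩ : ∃ g, h = 2*g+1 := ⟨h/2, by omega⟩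
    obtain rfl : ℓ = 4*g+3 := by omega
    have hc : g = 1 ∨ g = 2 ∨ g = 3 ∨ g = 4 ∨ g = 5 ∨ g = 6 ∨ g = 7 ∨ g = 8 ∨ 9 ≤ g := by omega
    rcases hc with rfl | rfl | rfl | rfl | rfl | rfl | rfl | rfl | hg
    · convert small_7
    · convert small_11
    · convert small_15
    · convert small_19
    · convert small_23
    · convert small_27
    · convert small_31
    · convert small_35
    · convert B_ok g hg

theorem stmt15 (ℓ v : ℕ) (hℓ : 7 ≤ ℓ) (hodd : Odd ℓ) (hv : 0 < v)
    (hmod : v % (2 * ℓ) = ℓ) :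
    letI : NeZero ℓ := ⟨by omega⟩
    HasEquitable2Decomp (⊤ : SimpleGraph (Fin v)) ℓ := by
  haveI : NeZero ℓ := ⟨by omega⟩
  obtain ⟨h, hh⟩ := hodd
  have key : v = (2*(v/(2*ℓ))+1)*ℓ := by
    have := Nat.div_add_mod v (2*ℓ)
    rw [hmod] at this
    linarith [this, mul_comm (2*ℓ) (v/(2*ℓ)), mul_assoc (2:ℕ) ℓ (v/(2*ℓ)), mul_assoc (2:ℕ) (v/(2*ℓ)) ℓ, mul_comm ℓ (v/(2*ℓ)), add_mul (2*(v/(2*ℓ))) 1 ℓ]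
  generalize v/(2*ℓ) = k at key
  subst key
  exact main_of_X ℓ h _ k hh (by omega) rfl (XOk_all ℓ h hℓ hh)
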